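/- For every integer q ≥ 1 there exists a constant C = C(q) > 0 with the following property. Let K be a finite nonempty subset of Δ̃_q := {(i_1,…,i_q) ∈ ℕ^q : all coordinates distinct} that is invariant under permutations of the coordinates, let (b_k)_{k ∈ ℕ} be real numbers with μ_b^{⊗q}(K) > 0, and let (X_k)_{k ∈ ℕ} be independent identically distributed real random variables with E[X_1] = 0, E[X_1²] = 1 and E[X_1⁴] < ∞. Set S := (q! μ_b^{⊗q}(K))^{−1/2} Σ_{(i_1,…,i_q) ∈ K} b_{i_1} ⋯ b_{i_q} X_{i_1} ⋯ X_{i_q}. Then d_W(S, 𝒩) ≤ C (E[X_1⁴])^q [ √(μ_b^{⊗2q}(K^#)) / μ_b^{⊗q}(K) + ( sup_{j ∈ ℕ} μ_b^{⊗q}(K*_j) / μ_b^{⊗q}(K) )^{1/4} ]. -/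

import Mathlib

open MeasureTheory ProbabilityTheory
open scoped Classical

/-- Wasserstein distance between two laws on `ℝ`, as a supremum over
1-Lipschitz test functions. -/
noncomputable def dW (μ ν : Measure ℝ) : ℝ :=
  ⨆ h : {f : ℝ → ℝ // LipschitzWith 1 f}, |(∫ x, h.1 x ∂μ) - ∫ x, h.1 x ∂ν|

/-- The standard Gaussian law `N(0,1)` on `ℝ`. -/
noncomputable def stdGaussian : Measure ℝ := gaussianReal 0 1

/-- `μ_b^{⊗q}(K) = Σ_{(i_1,…,i_q) ∈ K} b_{i_1}² ⋯ b_{i_q}²`. -/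
noncomputable def muB {q : ℕ} (b : ℕ → ℝ) (K : Finset (Fin q → ℕ)) : ℝ :=
  ∑ v ∈ K, ∏ i, (b (v i)) ^ 2

/-- `K*_j`: the tuples of `K` having `j` among their coordinates. -/
noncomputable def Kstar {q : ℕ} (K : Finset (Fin q → ℕ)) (j : ℕ) :
    Finset (Fin q → ℕ) :=
  K.filter (fun v => ∃ k, v k = j)

/-- `K^#`: pairs of tuples of `K` with disjoint coordinate sets which can be
recombined nontrivially into two other tuples of `K`. -/
noncomputable def Ksharp {q : ℕ} (K : Finset (Fin q → ℕ)) :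
    Finset ((Fin q → ℕ) × (Fin q → ℕ)) :=
  (K ×ˢ K).filter (fun p =>
    Set.range p.1 ∩ Set.range p.2 = ∅ ∧
    ∃ k ∈ K, ∃ l ∈ K,
      Set.range k ∪ Set.range l = Set.range p.1 ∪ Set.range p.2 ∧
      Set.range k ≠ Set.range p.1 ∧ Set.range k ≠ Set.range p.2)

/-- `μ_b^{⊗2q}(K^#)`. -/
noncomputable def muBsharp {q : ℕ} (b : ℕ → ℝ) (K : Finset (Fin q → ℕ)) : ℝ :=
  ∑ p ∈ Ksharp K, (∏ i, (b (p.1 i)) ^ 2) * ∏ i, (b (p.2 i)) ^ 2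

section SteinSolution
open Filter Topology Set

theorem le_gaussian_tail {G v : ℝ → ℝ} {B₀ B₁ : ℝ} (hB₁ : 0 ≤ B₁)
    (hG : ∀ x, HasDerivAt G (v x) x) (hlim : Tendsto G atTop (𝓝 0))
    (hv : ∀ x, 0 ≤ x → -((B₀ * x + B₁) * Real.exp (-(x ^ 2 / 2))) ≤ v x) {x : ℝ} (hx : 0 ≤ x) :
    G x ≤ (B₀ + 2 * B₁ / (1 + x)) * Real.exp (-(x ^ 2 / 2)) := by
  set Ψ : ℝ → ℝ := fun x => (B₀ + 2 * B₁ / (1 + x)) * Real.exp (-(x ^ 2 / 2)) with hΨ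
  set Ψ' : ℝ → ℝ := fun x => (-(2 * B₁) / (1 + x) ^ 2) * Real.exp (-(x ^ 2 / 2)) +
    (B₀ + 2 * B₁ / (1 + x)) * (Real.exp (-(x ^ 2 / 2)) * (-x)) with hΨ'
  have hderiv : ∀ x, 0 ≤ x → HasDerivAt Ψ (Ψ' x) x := by
    intro x hx
    have h1 : HasDerivAt (fun x : ℝ => B₀ + 2 * B₁ / (1 + x)) (-(2 * B₁) / (1 + x) ^ 2) x := by
      have := ((hasDerivAt_const x (2 * B₁)).div ((hasDerivAt_id x).const_add 1)
        (by simp only [id]; positivity)).const_add B₀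
      convert! this using 1
      simp
    have h2 : HasDerivAt (fun x : ℝ => Real.exp (-(x ^ 2 / 2)))
        (Real.exp (-(x ^ 2 / 2)) * (-x)) x := by
      have := (((hasDerivAt_id x).pow 2).div_const 2).neg.exp
      convert! this using 1
      simp
    exact h1.mul h2
  have hle : ∀ x, 0 ≤ x → Ψ' x ≤ v x := by
    intro x hx
    refine le_trans ?_ (hv x hx)
    have he := Real.exp_pos (-(x ^ 2 / 2))
    have : Ψ' x = -((B₀ * x + B₁ * (2 / (1 + x) ^ 2 + 2 * x / (1 + x))) *
        Real.exp (-(x ^ 2 / 2))) := by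
      simp only [hΨ']
      field_simp
      ring
    rw [this, neg_le_neg_iff]
    refine mul_le_mul_of_nonneg_right ?_ he.le
    have h3 : 1 ≤ 2 / (1 + x) ^ 2 + 2 * x / (1 + x) := by
      have : 2 / (1 + x) ^ 2 + 2 * x / (1 + x) = (2 + 2 * x + 2 * x ^ 2) / (1 + x) ^ 2 := by
        field_simp
        ring
      rw [this, le_div_iff₀ (by positivity)]
      nlinarith
    nlinarith
  have hmono : MonotoneOn (fun x => G x - Ψ x) (Ici 0) := by
    refine monotoneOn_of_hasDerivWithinAt_nonneg (f' := fun x => v x - Ψ' x) (convex_Ici 0) ?_ ?_ ?_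
    · intro y hy
      exact ((hG y).sub (hderiv y hy)).continuousAt.continuousWithinAt
    · intro y hy
      rw [interior_Ici] at hy
      exact ((hG y).sub (hderiv y (le_of_lt hy))).hasDerivWithinAt
    · intro y hy
      rw [interior_Ici] at hy
      exact sub_nonneg.2 (hle y (le_of_lt hy))
  have hΨlim : Tendsto Ψ atTop (𝓝 0) := by
    have h1 : Tendsto (fun x : ℝ => B₀ + 2 * B₁ / (1 + x)) atTop (𝓝 (B₀ + 0)) :=
      tendsto_const_nhds.add (tendsto_const_nhds.div_atTop
        (tendsto_atTop_add_const_left _ _ tendsto_id))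
    have h2 : Tendsto (fun x : ℝ => Real.exp (-(x ^ 2 / 2))) atTop (𝓝 0) :=
      Real.tendsto_exp_neg_atTop_nhds_zero.comp
        ((tendsto_pow_atTop two_ne_zero).atTop_div_const two_pos)
    simpa using h1.mul h2
  have hlim' : Tendsto (fun x => G x - Ψ x) atTop (𝓝 0) := by simpa using hlim.sub hΨlim
  have := ge_of_tendsto hlim' (b := G x - Ψ x) (by
    filter_upwards [eventually_ge_atTop x] with y hy
    exact hmono hx (le_trans hx hy) hy)
  linarith

theorem abs_le_gaussian_tail {G v : ℝ → ℝ} {B₀ B₁ : ℝ} (hB₁ : 0 ≤ B₁)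
    (hG : ∀ x, HasDerivAt G (v x) x) (htop : Tendsto G atTop (𝓝 0)) (hbot : Tendsto G atBot (𝓝 0))
    (hv : ∀ x, |v x| ≤ (B₀ * |x| + B₁) * Real.exp (-(x ^ 2 / 2))) (x : ℝ) :
    |G x| ≤ (B₀ + 2 * B₁ / (1 + |x|)) * Real.exp (-(x ^ 2 / 2)) := by
  have key : ∀ (G v : ℝ → ℝ), (∀ x, HasDerivAt G (v x) x) → Tendsto G atTop (𝓝 0) →
      (∀ x, |v x| ≤ (B₀ * |x| + B₁) * Real.exp (-(x ^ 2 / 2))) → ∀ x, 0 ≤ x →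
      |G x| ≤ (B₀ + 2 * B₁ / (1 + |x|)) * Real.exp (-(x ^ 2 / 2)) := by
    intro G v hG hlim hv x hx
    rw [abs_of_nonneg hx, abs_le']
    constructor
    · refine le_gaussian_tail hB₁ hG hlim (fun y hy => ?_) hx
      have := hv y
      rw [abs_of_nonneg hy] at this
      exact (abs_le.1 this).1
    · refine le_gaussian_tail (G := fun x => -G x) (v := fun x => -v x) hB₁ (fun y => (hG y).neg)
        (by simpa using hlim.neg) (fun y hy => ?_) hx
      have := hv y
      rw [abs_of_nonneg hy] at this
      exact neg_le_neg (abs_le.1 this).2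
  rcases le_total 0 x with hx | hx
  · exact key G v hG htop hv x hx
  · have := key (fun x => G (-x)) (fun x => -v (-x)) (fun y => ?_)
      (hbot.comp tendsto_neg_atTop_atBot) (fun y => ?_) (-x) (by linarith)
    · simpa using this
    · have := (hG (-y)).comp y (hasDerivAt_neg y)
      simpa [Function.comp_def] using this
    · simpa using hv (-y)

theorem LipschitzWith.integrable_of_integrable_id {μ : Measure ℝ} [IsFiniteMeasure μ] {h : ℝ → ℝ}
    (hh : LipschitzWith 1 h) (hid : Integrable (fun x : ℝ => x) μ) : Integrable h μ := by
  refine Integrable.mono' (hid.norm.add (integrable_const |h 0|))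
    hh.continuous.aestronglyMeasurable (ae_of_all _ fun y => ?_)
  have : |h y - h 0| ≤ |y - 0| := by simpa [Real.dist_eq] using hh.dist_le_mul y 0
  simp only [sub_zero] at this
  simp only [Pi.add_apply, Real.norm_eq_abs]
  calc |h y| = |(h y - h 0) + h 0| := by ring_nf
    _ ≤ _ := (abs_add_le _ _).trans (by linarith)

theorem abs_sub_integral_gaussian_le {h : ℝ → ℝ} (hh : LipschitzWith 1 h) (x : ℝ) :
    |h x - ∫ y, h y ∂gaussianReal 0 1| ≤ |x| + 1 := by
  have hid : MemLp (fun x : ℝ => x) 2 (gaussianReal 0 1) := memLp_id_gaussianReal' 2 (by simp)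
  have hid1 : Integrable (fun x : ℝ => x) (gaussianReal 0 1) := hid.integrable (by norm_num)
  have hsq : Integrable (fun x : ℝ => x ^ 2) (gaussianReal 0 1) := hid.integrable_sq
  have hsqv : ∫ x : ℝ, x ^ 2 ∂gaussianReal 0 1 = 1 := by
    have := variance_id_gaussianReal (μ := 0) (v := 1)
    rw [variance_of_integral_eq_zero (by fun_prop) (by simp)] at this
    simpa using this
  have hd : ∀ x y, |h x - h y| ≤ |x - y| := fun x y => by
    simpa [Real.dist_eq] using hh.dist_le_mul x y
  have h_int : Integrable h (gaussianReal 0 1) := hh.integrable_of_integrable_id hid1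
  have h1 : h x - ∫ y, h y ∂gaussianReal 0 1 = ∫ y, (h x - h y) ∂gaussianReal 0 1 := by
    rw [integral_sub (integrable_const _) h_int]; simp
  rw [h1]
  calc |∫ y, (h x - h y) ∂gaussianReal 0 1| ≤ ∫ y, |h x - h y| ∂gaussianReal 0 1 :=
        abs_integral_le_integral_abs
    _ ≤ ∫ y, (|x| + (1 + y ^ 2) / 2) ∂gaussianReal 0 1 := by
        refine integral_mono ((integrable_const _).sub h_int).abs
          ((integrable_const _).add (((integrable_const _).add hsq).div_const 2)) fun y => ?_
        refine (hd x y).trans ((abs_sub _ _).trans ?_)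
        have : |y| ≤ (1 + y ^ 2) / 2 := by nlinarith [sq_nonneg (|y| - 1), sq_abs y]
        linarith
    _ = |x| + 1 := by
        have hi : Integrable (fun y : ℝ => (1 + y ^ 2) / 2) (gaussianReal 0 1) :=
          ((integrable_const _).add hsq).div_const 2
        rw [integral_add (integrable_const _) hi, integral_div,
          integral_add (integrable_const _) hsq, hsqv]
        simp

theorem exists_primitive_gaussian {h : ℝ → ℝ} (hh : LipschitzWith 1 h) :
    ∃ H : ℝ → ℝ, (∀ x, HasDerivAt H
      ((h x - ∫ y, h y ∂gaussianReal 0 1) * Real.exp (-(x ^ 2 / 2))) x) ∧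
      Tendsto H atTop (𝓝 0) ∧ Tendsto H atBot (𝓝 0) := by
  set c := ∫ y, h y ∂gaussianReal 0 1 with hc
  set u : ℝ → ℝ := fun x => (h x - c) * Real.exp (-(x ^ 2 / 2)) with hu
  have h_int : Integrable h (gaussianReal 0 1) := hh.integrable_of_integrable_id
    ((memLp_id_gaussianReal' 2 (by simp)).integrable (by norm_num))
  have hcont : Continuous u := by
    have := hh.continuous
    fun_prop
  have hpdf : ∀ x, gaussianPDFReal 0 1 x = (√(2 * Real.pi))⁻¹ * Real.exp (-(x ^ 2 / 2)) := by
    intro x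
    simp [gaussianPDFReal, neg_div]
  have hpos : (0 : ℝ) < (√(2 * Real.pi))⁻¹ := by positivity
  have h_int' : Integrable (fun x => h x - c) (gaussianReal 0 1) := h_int.sub (integrable_const _)
  have hzero : ∫ x, (h x - c) ∂gaussianReal 0 1 = 0 := by
    rw [integral_sub h_int (integrable_const _)]; simp [hc]
  have huint : Integrable u := by
    rw [gaussianReal_of_var_ne_zero 0 (by simp : (1 : NNReal) ≠ 0),
      integrable_withDensity_iff_integrable_smul₀' (by fun_prop)
        (ae_of_all _ fun x => gaussianPDF_lt_top)] at h_int'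
    simp only [toReal_gaussianPDF, hpdf, smul_eq_mul] at h_int'
    have := h_int'.const_mul (√(2 * Real.pi))
    refine this.congr (ae_of_all _ fun x => ?_)
    simp only [hu]
    field_simp
  have huzero : ∫ x, u x = 0 := by
    rw [integral_gaussianReal_eq_integral_smul (by simp)] at hzero
    simp only [hpdf, smul_eq_mul] at hzero
    simp only [mul_assoc] at hzero
    rw [integral_const_mul] at hzero
    rcases mul_eq_zero.1 hzero with h0 | h0
    · exact absurd h0 hpos.ne'
    · simpa only [hu, mul_comm] using h0
  refine ⟨fun x => (∫ t in Iic 0, u t) + ∫ t in (0 : ℝ)..x, u t, fun x => ?_, ?_, ?_⟩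
  · exact (intervalIntegral.integral_hasDerivAt_right (hcont.intervalIntegrable _ _)
      (hcont.stronglyMeasurableAtFilter _ _) hcont.continuousAt).const_add _
  · have := (intervalIntegral_tendsto_integral_Ioi 0 huint.integrableOn tendsto_id).const_add
      (∫ t in Iic 0, u t)
    rwa [intervalIntegral.integral_Iic_add_Ioi huint.integrableOn huint.integrableOn,
      huzero] at this
  · have := (intervalIntegral_tendsto_integral_Iic 0 huint.integrableOn tendsto_id).const_sub
      (∫ t in Iic 0, u t)
    rw [sub_self] at this
    refine this.congr fun x => ?_
    rw [intervalIntegral.integral_symm]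
    simp

/-- The solution of the Stein equation for a differentiable 1-Lipschitz test function is bounded
with bounded first and second derivatives. -/
theorem exists_stein_solution {h h' : ℝ → ℝ} (hh : LipschitzWith 1 h)
    (hderiv : ∀ x, HasDerivAt h (h' x) x) (hh' : ∀ x, |h' x| ≤ 1) :
    ∃ f f' f'' : ℝ → ℝ, (∀ x, HasDerivAt f (f' x) x) ∧ (∀ x, HasDerivAt f' (f'' x) x) ∧
      (∀ x, |f x| ≤ 3) ∧ (∀ x, |f' x| ≤ 8) ∧ (∀ x, |f'' x| ≤ 12) ∧
      ∀ x, x * f x = f' x - (h x - ∫ y, h y ∂gaussianReal 0 1) := by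
  obtain ⟨H, hH, htop, hbot⟩ := exists_primitive_gaussian hh
  have hbd := abs_sub_integral_gaussian_le hh
  set c := ∫ y, h y ∂gaussianReal 0 1 with hc
  have hE : ∀ x : ℝ, HasDerivAt (fun x : ℝ => Real.exp (x ^ 2 / 2)) 
      (x * Real.exp (x ^ 2 / 2)) x := by
    intro x
    have := (((hasDerivAt_id x).pow 2).div_const 2).exp
    convert! this using 1
    simp [mul_comm]
  have hE' : ∀ x : ℝ, HasDerivAt (fun x : ℝ => Real.exp (-(x ^ 2 / 2)))
      (-x * Real.exp (-(x ^ 2 / 2))) x := by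
    intro x
    have := (((hasDerivAt_id x).pow 2).div_const 2).neg.exp
    convert! this using 1
    simp [mul_comm]
  have hEE : ∀ x : ℝ, Real.exp (-(x ^ 2 / 2)) * Real.exp (x ^ 2 / 2) = 1 := by
    intro x; rw [← Real.exp_add]; simp
  set f : ℝ → ℝ := fun x => H x * Real.exp (x ^ 2 / 2) with hf
  set f' : ℝ → ℝ := fun x => x * f x + (h x - c) with hf'
  set f'' : ℝ → ℝ := fun x => f x + x * f' x + h' x with hf''
  have hfd : ∀ x, HasDerivAt f (f' x) x := by
    intro x
    convert! (hH x).mul (hE x) using 1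
    simp only [hf', hf]
    linear_combination (-(h x - c)) * hEE x
  have hfd' : ∀ x, HasDerivAt f' (f'' x) x := by
    intro x
    convert! ((hasDerivAt_id x).mul (hfd x)).add ((hderiv x).sub_const c) using 1
    simp [hf'']
  have hf3 : ∀ x, |f x| ≤ 3 := by
    intro x
    have h1 := abs_le_gaussian_tail (B₀ := 1) (B₁ := 1) zero_le_one hH htop hbot (fun x => by
      rw [abs_mul, abs_of_pos (Real.exp_pos _), one_mul]
      exact mul_le_mul_of_nonneg_right (hbd x) (Real.exp_pos _).le) x
    simp only [hf]
    rw [abs_mul, abs_of_pos (Real.exp_pos (x ^ 2 / 2))]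
    have h2 := mul_le_mul_of_nonneg_right h1 (Real.exp_pos (x ^ 2 / 2)).le
    rw [mul_assoc, hEE, mul_one] at h2
    have : 2 * (1 : ℝ) / (1 + |x|) ≤ 2 := by
      rw [div_le_iff₀ (by positivity)]
      linarith [abs_nonneg x]
    linarith
  have hgrow : ∀ x, |f' x| ≤ 4 * |x| + 1 := by
    intro x
    refine (abs_add_le _ _).trans ?_
    rw [abs_mul]
    nlinarith [hf3 x, hbd x, abs_nonneg x]
  have hexp0 : Tendsto (fun x : ℝ => (4 * x + 1) * Real.exp (-(x ^ 2 / 2))) atTop (𝓝 0) := by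
    have h1 : Tendsto (fun x : ℝ => 4 * (x ^ 1 * Real.exp (-x)) + x ^ 0 * Real.exp (-x)) atTop
        (𝓝 (4 * 0 + 0)) :=
      ((Real.tendsto_pow_mul_exp_neg_atTop_nhds_zero 1).const_mul 4).add
        (Real.tendsto_pow_mul_exp_neg_atTop_nhds_zero 0)
    simp only [mul_zero, add_zero] at h1
    refine squeeze_zero' ?_ ?_ h1
    · filter_upwards [eventually_ge_atTop 0] with x hx
      positivity
    · filter_upwards [eventually_ge_atTop 2] with x hx
      have : Real.exp (-(x ^ 2 / 2)) ≤ Real.exp (-x) := Real.exp_le_exp.2 (by nlinarith)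
      nlinarith
  set G : ℝ → ℝ := fun x => f' x * Real.exp (-(x ^ 2 / 2)) with hGdef
  have hGb : ∀ x, |G x| ≤ (4 * |x| + 1) * Real.exp (-(|x| ^ 2 / 2)) := by
    intro x
    simp only [hGdef]
    rw [abs_mul, abs_of_pos (Real.exp_pos _), sq_abs]
    exact mul_le_mul_of_nonneg_right (hgrow x) (Real.exp_pos _).le
  have hGtop : Tendsto G atTop (𝓝 0) := squeeze_zero_norm hGb (hexp0.comp tendsto_abs_atTop_atTop)
  have hGbot : Tendsto G atBot (𝓝 0) := squeeze_zero_norm hGb (hexp0.comp tendsto_abs_atBot_atTop)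
  have hGd : ∀ x, HasDerivAt G ((f x + h' x) * Real.exp (-(x ^ 2 / 2))) x := by
    intro x
    convert! (hfd' x).mul (hE' x) using 1
    simp only [hf'']
    ring
  have hf'b : ∀ x, |f' x| ≤ 8 / (1 + |x|) := by
    intro x
    have h1 := abs_le_gaussian_tail (B₀ := 0) (B₁ := 4) (by norm_num) hGd hGtop hGbot (fun x => by
      rw [abs_mul, abs_of_pos (Real.exp_pos _)]
      refine mul_le_mul_of_nonneg_right ?_ (Real.exp_pos _).le
      refine (abs_add_le _ _).trans ?_
      linarith [hf3 x, hh' x]) x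
    simp only [hGdef] at h1
    rw [abs_mul, abs_of_pos (Real.exp_pos _)] at h1
    have := le_of_mul_le_mul_right h1 (Real.exp_pos _)
    norm_num at this
    exact this
  refine ⟨f, f', f'', hfd, hfd', hf3, fun x => (hf'b x).trans ?_, fun x => ?_, fun x => ?_⟩
  · rw [div_le_iff₀ (by positivity)]
    linarith [abs_nonneg x]
  · have h1 : |x * f' x| ≤ 8 := by
      rw [abs_mul]
      refine (mul_le_mul_of_nonneg_left (hf'b x) (abs_nonneg x)).trans ?_
      rw [← mul_div_assoc, div_le_iff₀ (by positivity)]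
      linarith [abs_nonneg x]
    refine (abs_add_le _ _).trans ?_
    have := abs_add_le (f x) (x * f' x)
    linarith [hf3 x, hh' x]
  · simp only [hf']
    ring

theorem abs_sub_sub_mul_le {f f' f'' : ℝ → ℝ} {L : ℝ} (hf : ∀ x, HasDerivAt f (f' x) x)
    (hf' : ∀ x, HasDerivAt f' (f'' x) x) (hL : ∀ x, |f'' x| ≤ L) (x y : ℝ) :
    |f x - f y - (x - y) * f' x| ≤ L * |x - y| ^ 2 := by
  have hL0 : 0 ≤ L := (abs_nonneg _).trans (hL 0)
  have hlip : ∀ u v, |f' u - f' v| ≤ L * |u - v| := fun u v =>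
    Convex.norm_image_sub_le_of_norm_hasDerivWithin_le (s := univ)
      (fun z _ => (hf' z).hasDerivWithinAt) (fun z _ => hL z) convex_univ trivial trivial
  have hg : ∀ z, HasDerivAt (fun z => f z - z * f' x) (f' z - f' x) z := fun z => by
    convert! (hf z).sub ((hasDerivAt_id z).mul_const (f' x)) using 1
    simp
  have := Convex.norm_image_sub_le_of_norm_hasDerivWithin_le (s := uIcc x y) (C := L * |x - y|)
    (f := fun z => f z - z * f' x) (f' := fun z => f' z - f' x) (x := y) (y := x)
      (fun z _ => (hg z).hasDerivWithinAt) (fun z hz => (hlip z x).trans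
        (mul_le_mul_of_nonneg_left ?_ hL0)) (convex_uIcc x y) right_mem_uIcc left_mem_uIcc
  · simp only [Real.norm_eq_abs] at this
    rw [sq, ← mul_assoc]
    convert this using 2
    ring
  · rw [abs_sub_comm x y]
    exact abs_sub_left_of_mem_uIcc hz

/-- Every 1-Lipschitz function is uniformly close to a differentiable 1-Lipschitz function. -/
theorem exists_differentiable_lipschitz_approx {h : ℝ → ℝ} (hh : LipschitzWith 1 h) {ε : ℝ}
    (hε : 0 < ε) :
    ∃ g g' : ℝ → ℝ, LipschitzWith 1 g ∧ (∀ x, HasDerivAt g (g' x) x) ∧ (∀ x, |g' x| ≤ 1) ∧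
      ∀ x, |g x - h x| ≤ ε := by
  have hd : ∀ x y, |h x - h y| ≤ |x - y| := fun x y => by
    simpa [Real.dist_eq] using hh.dist_le_mul x y
  have hc := hh.continuous
  set P : ℝ → ℝ := fun x => ∫ t in (0 : ℝ)..x, h t with hP
  have hPd : ∀ x, HasDerivAt P (h x) x := fun x =>
    intervalIntegral.integral_hasDerivAt_right (hc.intervalIntegrable _ _)
      (hc.stronglyMeasurableAtFilter _ _) hc.continuousAt
  set g : ℝ → ℝ := fun x => (P (x + ε) - P x) / ε with hg
  set g' : ℝ → ℝ := fun x => (h (x + ε) - h x) / ε with hg'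
  have hgd : ∀ x, HasDerivAt g (g' x) x := fun x =>
    (((hPd (x + ε)).comp_add_const x ε).sub (hPd x)).div_const ε
  have hgb : ∀ x, |g' x| ≤ 1 := fun x => by
    simp only [hg']
    rw [abs_div, abs_of_pos hε, div_le_one hε]
    have := hd (x + ε) x
    rwa [add_sub_cancel_left, abs_of_pos hε] at this
  refine ⟨g, g', ?_, hgd, hgb, fun x => ?_⟩
  · refine lipschitzWith_of_nnnorm_deriv_le (fun x => (hgd x).differentiableAt) fun x => ?_
    rw [(hgd x).deriv, ← NNReal.coe_le_coe]
    simpa using hgb x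
  · have h1 := Convex.norm_image_sub_le_of_norm_hasDerivWithin_le (s := Icc x (x + ε)) (C := ε)
      (f := fun z => P z - z * h x) (f' := fun z => h z - h x) (x := x) (y := x + ε)
      (fun z _ => by
        convert! ((hPd z).sub ((hasDerivAt_id z).mul_const (h x))).hasDerivWithinAt using 1
        simp)
      (fun z hz => (hd z x).trans (by rw [abs_of_nonneg (by linarith [hz.1])]; linarith [hz.2]))
      (convex_Icc _ _) ⟨le_rfl, by linarith⟩ ⟨by linarith, le_rfl⟩
    simp only [Real.norm_eq_abs, add_sub_cancel_left] at h1
    have h2 : g x - h x = (P (x + ε) - (x + ε) * h x - (P x - x * h x)) / ε := by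
      simp only [hg]
      field_simp
      ring
    rw [h2, abs_div, abs_of_pos hε, div_le_iff₀ hε]
    rwa [abs_of_pos hε] at h1

end SteinSolution

section SteinBound

theorem abs_integral_sub_gaussian_le_of_differentiable {Ω ι : Type*} [MeasurableSpace Ω]
    {P : Measure Ω} [IsProbabilityMeasure P] {s : Finset ι} {Y : ι → Ω → ℝ} {W : Ω → ℝ} {q : ℝ}
    (hq : 0 < q) (hY : ∀ j ∈ s, Measurable (Y j)) (hY4 : ∀ j ∈ s, MemLp (Y j) 4 P)
    (hW : ∀ ω, W ω = q⁻¹ * ∑ j ∈ s, Y j ω)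
    (hdec : ∀ j ∈ s, ∀ f : ℝ → ℝ, Continuous f → (∀ x, |f x| ≤ 3) →
      ∫ ω, Y j ω * f (W ω - Y j ω) ∂P = 0)
    {h h' : ℝ → ℝ} (hh : LipschitzWith 1 h) (hderiv : ∀ x, HasDerivAt h (h' x) x)
    (hh' : ∀ x, |h' x| ≤ 1) :
    |(∫ ω, h (W ω) ∂P) - ∫ y, h y ∂gaussianReal 0 1| ≤
      8 * ∫ ω, |1 - q⁻¹ * ∑ j ∈ s, Y j ω ^ 2| ∂P +
        12 * q⁻¹ * ∑ j ∈ s, ∫ ω, |Y j ω| ^ 3 ∂P := by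
  obtain ⟨f, f', f'', hf, hf', hfb, hfb', hfb'', hst⟩ := exists_stein_solution hh hderiv hh'
  set c := ∫ y, h y ∂gaussianReal 0 1 with hc
  have hfc : Continuous f := continuous_iff_continuousAt.2 fun x => (hf x).continuousAt
  have hWm : Measurable W := by
    have : W = fun ω => q⁻¹ * ∑ j ∈ s, Y j ω := funext hW
    rw [this]
    exact (Finset.measurable_fun_sum s hY).const_mul _
  have hY1 : ∀ j ∈ s, Integrable (Y j) P := fun j hj => (hY4 j hj).integrable (by norm_num)
  have hY2 : ∀ j ∈ s, Integrable (fun ω => Y j ω ^ 2) P := fun j hj =>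
    ((hY4 j hj).mono_exponent (by norm_num) : MemLp (Y j) 2 P).integrable_sq
  have hY3 : ∀ j ∈ s, Integrable (fun ω => |Y j ω| ^ 3) P := fun j hj => by
    have := ((hY4 j hj).mono_exponent (p := 3) (by norm_num)).integrable_norm_pow (p := 3)
      (by norm_num)
    simpa using this
  have hW1 : Integrable W P := by
    have : W = fun ω => q⁻¹ * ∑ j ∈ s, Y j ω := funext hW
    rw [this]
    exact (integrable_finsetSum s hY1).const_mul _
  have hhW : Integrable (fun ω => h (W ω)) P := by
    refine Integrable.mono' (hW1.norm.add (integrable_const |h 0|))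
      (hh.continuous.measurable.comp hWm).aestronglyMeasurable (ae_of_all _ fun ω => ?_)
    have : |h (W ω) - h 0| ≤ |W ω - 0| := by simpa [Real.dist_eq] using hh.dist_le_mul (W ω) 0
    simp only [sub_zero] at this
    simp only [Pi.add_apply, Real.norm_eq_abs]
    calc |h (W ω)| = |(h (W ω) - h 0) + h 0| := by ring_nf
      _ ≤ _ := (abs_add_le _ _).trans (by linarith)
  have hYf : ∀ j ∈ s, Integrable (fun ω => Y j ω * f (W ω - Y j ω)) P := fun j hj =>
    (hY1 j hj).mul_bdd (c := 3)
      (hfc.measurable.comp (hWm.sub (hY j hj))).aestronglyMeasurable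
      (ae_of_all _ fun ω => hfb _)
  have hR : (∫ ω, h (W ω) ∂P) - c =
      ∫ ω, ((h (W ω) - c) + q⁻¹ * ∑ j ∈ s, Y j ω * f (W ω - Y j ω)) ∂P := by
    have h1 : Integrable (fun ω => h (W ω) - c) P := hhW.sub (integrable_const _)
    have h2 : Integrable (fun ω => q⁻¹ * ∑ j ∈ s, Y j ω * f (W ω - Y j ω)) P :=
      (integrable_finsetSum s hYf).const_mul _
    rw [integral_add h1 h2, integral_const_mul, integral_finsetSum s hYf,
      Finset.sum_eq_zero (fun j hj => hdec j hj f hfc hfb), integral_sub hhW (integrable_const _)]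
    simp
  have hT : Integrable (fun ω => |1 - q⁻¹ * ∑ j ∈ s, Y j ω ^ 2|) P :=
    ((integrable_const _).sub ((integrable_finsetSum s hY2).const_mul _)).abs
  have hS3 : Integrable (fun ω => ∑ j ∈ s, |Y j ω| ^ 3) P := integrable_finsetSum s hY3
  have hbound : ∀ ω, ‖(h (W ω) - c) + q⁻¹ * ∑ j ∈ s, Y j ω * f (W ω - Y j ω)‖ ≤
      8 * |1 - q⁻¹ * ∑ j ∈ s, Y j ω ^ 2| + 12 * q⁻¹ * ∑ j ∈ s, |Y j ω| ^ 3 := by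
    intro ω
    have e : (h (W ω) - c) + q⁻¹ * ∑ j ∈ s, Y j ω * f (W ω - Y j ω) =
        (1 - q⁻¹ * ∑ j ∈ s, Y j ω ^ 2) * f' (W ω) -
          q⁻¹ * ∑ j ∈ s, Y j ω * (f (W ω) - f (W ω - Y j ω) - Y j ω * f' (W ω)) := by
      have h1 : h (W ω) - c = f' (W ω) - W ω * f (W ω) := by rw [hst]; ring
      have h2 : W ω * f (W ω) = q⁻¹ * ∑ j ∈ s, Y j ω * f (W ω) := by
        rw [← Finset.sum_mul, ← mul_assoc, ← hW]
      have h3 : ∑ j ∈ s, Y j ω * (f (W ω) - f (W ω - Y j ω) - Y j ω * f' (W ω)) =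
          ∑ j ∈ s, Y j ω * f (W ω) - ∑ j ∈ s, Y j ω * f (W ω - Y j ω) -
            (∑ j ∈ s, Y j ω ^ 2) * f' (W ω) := by
        rw [Finset.sum_mul, ← Finset.sum_sub_distrib, ← Finset.sum_sub_distrib]
        exact Finset.sum_congr rfl fun j _ => by ring
      rw [h3, h1, h2]
      ring
    rw [e, Real.norm_eq_abs]
    refine (abs_sub _ _).trans (add_le_add ?_ ?_)
    · rw [abs_mul, mul_comm]
      exact mul_le_mul_of_nonneg_right (hfb' _) (abs_nonneg _)
    · rw [abs_mul, abs_of_pos (inv_pos.2 hq), mul_comm 12, mul_assoc, Finset.mul_sum]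
      refine mul_le_mul_of_nonneg_left ((Finset.abs_sum_le_sum_abs _ _).trans
        (Finset.sum_le_sum fun j _ => ?_)) (inv_pos.2 hq).le
      have := abs_sub_sub_mul_le hf hf' hfb'' (W ω) (W ω - Y j ω)
      rw [sub_sub_cancel] at this
      rw [abs_mul]
      calc _ ≤ |Y j ω| * (12 * |Y j ω| ^ 2) := mul_le_mul_of_nonneg_left this (abs_nonneg _)
        _ = _ := by ring
  rw [hR, ← Real.norm_eq_abs]
  refine (norm_integral_le_of_norm_le ((hT.const_mul 8).add (hS3.const_mul _))
    (ae_of_all _ hbound)).trans (le_of_eq ?_)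
  rw [integral_add' (hT.const_mul 8) (hS3.const_mul _), integral_const_mul, integral_const_mul,
    integral_finsetSum s hY3]

theorem abs_integral_sub_gaussian_le {Ω ι : Type*} [MeasurableSpace Ω]
    {P : Measure Ω} [IsProbabilityMeasure P] {s : Finset ι} {Y : ι → Ω → ℝ} {W : Ω → ℝ} {q : ℝ}
    (hq : 0 < q) (hY : ∀ j ∈ s, Measurable (Y j)) (hY4 : ∀ j ∈ s, MemLp (Y j) 4 P)
    (hW : ∀ ω, W ω = q⁻¹ * ∑ j ∈ s, Y j ω)
    (hdec : ∀ j ∈ s, ∀ f : ℝ → ℝ, Continuous f → (∀ x, |f x| ≤ 3) →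
      ∫ ω, Y j ω * f (W ω - Y j ω) ∂P = 0)
    {h : ℝ → ℝ} (hh : LipschitzWith 1 h) :
    |(∫ ω, h (W ω) ∂P) - ∫ y, h y ∂gaussianReal 0 1| ≤
      8 * ∫ ω, |1 - q⁻¹ * ∑ j ∈ s, Y j ω ^ 2| ∂P +
        12 * q⁻¹ * ∑ j ∈ s, ∫ ω, |Y j ω| ^ 3 ∂P := by
  have hWm : Measurable W := by
    have : W = fun ω => q⁻¹ * ∑ j ∈ s, Y j ω := funext hW
    rw [this]
    exact (Finset.measurable_fun_sum s hY).const_mul _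
  have hW1 : Integrable W P := by
    have : W = fun ω => q⁻¹ * ∑ j ∈ s, Y j ω := funext hW
    rw [this]
    exact (integrable_finsetSum s fun j hj => (hY4 j hj).integrable (by norm_num)).const_mul _
  have hmap : IsProbabilityMeasure (P.map W) := Measure.isProbabilityMeasure_map hWm.aemeasurable
  have hLip : ∀ {g : ℝ → ℝ}, LipschitzWith 1 g → Integrable g (P.map W) := fun hg =>
    hg.integrable_of_integrable_id
      ((integrable_map_measure (by fun_prop) hWm.aemeasurable).2 hW1)
  have hLip' : ∀ {g : ℝ → ℝ}, LipschitzWith 1 g → Integrable g (gaussianReal 0 1) := fun hg =>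
    hg.integrable_of_integrable_id
      ((memLp_id_gaussianReal' 2 (by simp)).integrable (by norm_num))
  have hclose : ∀ (μ : Measure ℝ) [IsProbabilityMeasure μ] (g₁ g₂ : ℝ → ℝ) (ε : ℝ),
      Integrable g₁ μ → Integrable g₂ μ → (∀ x, |g₁ x - g₂ x| ≤ ε) →
      |(∫ x, g₁ x ∂μ) - ∫ x, g₂ x ∂μ| ≤ ε := by
    intro μ _ g₁ g₂ ε h1 h2 hε
    rw [← integral_sub h1 h2, ← Real.norm_eq_abs]
    refine (norm_integral_le_of_norm_le_const (C := ε) (ae_of_all _ hε)).trans ?_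
    simp
  have htr : ∀ {g : ℝ → ℝ}, LipschitzWith 1 g → ∫ ω, g (W ω) ∂P = ∫ x, g x ∂(P.map W) :=
    fun hg => (integral_map hWm.aemeasurable hg.continuous.aestronglyMeasurable).symm
  refine le_of_forall_pos_le_add fun ε hε => ?_
  obtain ⟨g, g', hg, hgd, hgb, hgh⟩ :=
    exists_differentiable_lipschitz_approx hh (half_pos hε)
  have h1 := abs_integral_sub_gaussian_le_of_differentiable hq hY hY4 hW hdec hg hgd hgb
  have h2 := hclose (P.map W) g h _ (hLip hg) (hLip hh) hgh
  have h3 := hclose (gaussianReal 0 1) g h _ (hLip' hg) (hLip' hh) hgh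
  rw [htr hg] at h1
  rw [htr hh]
  rw [abs_le] at *
  constructor <;> linarith [h1.1, h1.2, h2.1, h2.2, h3.1, h3.2]

end SteinBound

section Covering
variable {α : Type*}

/-- The `ℓ²` norm of a function on the subsets of `s`, with weight `16 ^ #t`. -/
noncomputable def weightedNorm (s : Finset α) (g : Finset α → ℝ) : ℝ :=
  √(∑ t ∈ s.powerset, 16 ^ t.card * g t ^ 2)

theorem weightedNorm_nonneg (s : Finset α) (g : Finset α → ℝ) : 0 ≤ weightedNorm s g :=
  Real.sqrt_nonneg _

variable [DecidableEq α]

/-- Every element of one of the four sets lies in at least one of the other three. -/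
def DoublyCovered (J₁ J₂ J₃ J₄ : Finset α) : Prop :=
  J₁ ⊆ J₂ ∪ J₃ ∪ J₄ ∧ J₂ ⊆ J₁ ∪ J₃ ∪ J₄ ∧ J₃ ⊆ J₁ ∪ J₂ ∪ J₄ ∧ J₄ ⊆ J₁ ∪ J₂ ∪ J₃

/-- Insert `a` into `t` when the flag is set. -/
def insertIf (a : α) (u : Bool) (t : Finset α) : Finset α := if u then insert a t else t

/-- Exactly one of the four flags is set. -/
def exactlyOne (u₁ u₂ u₃ u₄ : Bool) : Bool :=
  (u₁ && !u₂ && !u₃ && !u₄) || (!u₁ && u₂ && !u₃ && !u₄) || (!u₁ && !u₂ && u₃ && !u₄) ||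
    (!u₁ && !u₂ && !u₃ && u₄)

theorem sum_powerset_insertIf {a : α} {s : Finset α} (ha : a ∉ s) (f : Finset α → ℝ) :
    ∑ t ∈ (insert a s).powerset, f t = ∑ u : Bool, ∑ t ∈ s.powerset, f (insertIf a u t) := by
  rw [Finset.sum_powerset_insert ha, Fintype.sum_bool, add_comm]
  simp [insertIf]

theorem weightedNorm_insert {a : α} {s : Finset α} (ha : a ∉ s) (g : Finset α → ℝ) :
    weightedNorm (insert a s) g = √(weightedNorm s (fun t => g (insertIf a false t)) ^ 2 +
      16 * weightedNorm s (fun t => g (insertIf a true t)) ^ 2) := by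
  unfold weightedNorm
  rw [Real.sq_sqrt (Finset.sum_nonneg fun _ _ => by positivity),
    Real.sq_sqrt (Finset.sum_nonneg fun _ _ => by positivity), Finset.sum_powerset_insert ha,
    Finset.mul_sum]
  congr 2
  refine Finset.sum_congr rfl fun t ht => ?_
  have : a ∉ t := fun h => ha (Finset.mem_powerset.1 ht h)
  rw [Finset.card_insert_of_notMem this]
  simp only [insertIf, if_true]
  ring

theorem DoublyCovered.of_insertIf {a : α} {s : Finset α} (ha : a ∉ s) {u₁ u₂ u₃ u₄ : Bool}
    {J₁ J₂ J₃ J₄ : Finset α} (h₁ : J₁ ⊆ s) (h₂ : J₂ ⊆ s) (h₃ : J₃ ⊆ s) (h₄ : J₄ ⊆ s)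
    (h : DoublyCovered (insertIf a u₁ J₁) (insertIf a u₂ J₂) (insertIf a u₃ J₃)
      (insertIf a u₄ J₄)) :
    exactlyOne u₁ u₂ u₃ u₄ = false ∧ DoublyCovered J₁ J₂ J₃ J₄ := by
  have k₁ : a ∉ J₁ := fun h => ha (h₁ h)
  have k₂ : a ∉ J₂ := fun h => ha (h₂ h)
  have k₃ : a ∉ J₃ := fun h => ha (h₃ h)
  have k₄ : a ∉ J₄ := fun h => ha (h₄ h)
  have mem : ∀ (u : Bool) (J : Finset α) (x : α),
      x ∈ insertIf a u J ↔ (u = true ∧ x = a) ∨ x ∈ J := by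
    intro u J x
    cases u <;> simp [insertIf]
  simp only [DoublyCovered, Finset.subset_iff, Finset.mem_union, mem] at h ⊢
  obtain ⟨c₁, c₂, c₃, c₄⟩ := h
  have d₁ := c₁ (x := a)
  have d₂ := c₂ (x := a)
  have d₃ := c₃ (x := a)
  have d₄ := c₄ (x := a)
  refine ⟨?_, ?_, ?_, ?_, ?_⟩
  · revert d₁ d₂ d₃ d₄
    cases u₁ <;> cases u₂ <;> cases u₃ <;> cases u₄ <;> simp [exactlyOne, k₁, k₂, k₃, k₄]
  all_goals
    intro x hx
    have hxa : x ≠ a := by rintro rfl; contradiction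
  · simpa [hxa] using c₁ (Or.inr hx)
  · simpa [hxa] using c₂ (Or.inr hx)
  · simpa [hxa] using c₃ (Or.inr hx)
  · simpa [hxa] using c₄ (Or.inr hx)

theorem sq_add_sum_le {A x₁ x₂ x₃ x₄ y₁₂ y₁₃ y₁₄ y₂₃ y₂₄ y₃₄ z₁ z₂ z₃ z₄ w : ℝ}
    (h₁₂ : A * y₁₂ = x₁ * x₂) (h₁₃ : A * y₁₃ = x₁ * x₃) (h₁₄ : A * y₁₄ = x₁ * x₄)
    (h₂₃ : A * y₂₃ = x₂ * x₃) (h₂₄ : A * y₂₄ = x₂ * x₄) (h₃₄ : A * y₃₄ = x₃ * x₄)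
    (h₁ : A * z₁ = x₂ * y₃₄) (h₂ : A * z₂ = x₁ * y₃₄) (h₃ : A * z₃ = x₁ * y₂₄)
    (h₄ : A * z₄ = x₁ * y₂₃) (hw : A * w = y₁₂ * y₃₄) :
    (A + (y₁₂ + y₁₃ + y₁₄ + y₂₃ + y₂₄ + y₃₄ + z₁ + z₂ + z₃ + z₄ + w) / 16) ^ 2 ≤
      A ^ 2 + (x₁ ^ 2 + x₂ ^ 2 + x₃ ^ 2 + x₄ ^ 2 + y₁₂ ^ 2 + y₁₃ ^ 2 + y₁₄ ^ 2 + y₂₃ ^ 2 +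
        y₂₄ ^ 2 + y₃₄ ^ 2 + z₁ ^ 2 + z₂ ^ 2 + z₃ ^ 2 + z₄ ^ 2 + w ^ 2) := by
  set N := x₁ ^ 2 + x₂ ^ 2 + x₃ ^ 2 + x₄ ^ 2 + y₁₂ ^ 2 + y₁₃ ^ 2 + y₁₄ ^ 2 + y₂₃ ^ 2 +
        y₂₄ ^ 2 + y₃₄ ^ 2 + z₁ ^ 2 + z₂ ^ 2 + z₃ ^ 2 + z₄ ^ 2 + w ^ 2 with hN
  set m := y₁₂ + y₁₃ + y₁₄ + y₂₃ + y₂₄ + y₃₄ + z₁ + z₂ + z₃ + z₄ + w with hm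
  have hs : m ^ 2 ≤ 11 * N := by
    have hc := Finset.sum_mul_sq_le_sq_mul_sq (Finset.univ : Finset (Fin 11)) (fun _ => (1 : ℝ))
      ![y₁₂, y₁₃, y₁₄, y₂₃, y₂₄, y₃₄, z₁, z₂, z₃, z₄, w]
    simp [Fin.sum_univ_succ] at hc
    have e : m = y₁₂ + (y₁₃ + (y₁₄ + (y₂₃ + (y₂₄ + (y₃₄ + (z₁ + (z₂ + (z₃ + (z₄ + w))))))))) := by
      rw [hm]; ring
    rw [e]
    linarith [sq_nonneg x₁, sq_nonneg x₂, sq_nonneg x₃, sq_nonneg x₄]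
  have amgm : ∀ x y : ℝ, x * y ≤ (x ^ 2 + y ^ 2) / 2 := fun x y => by nlinarith [sq_nonneg (x - y)]
  have hl : A * m ≤ 11 / 2 * N := by
    have : A * m = x₁ * x₂ + x₁ * x₃ + x₁ * x₄ + x₂ * x₃ + x₂ * x₄ + x₃ * x₄ + x₂ * y₃₄ +
        x₁ * y₃₄ + x₁ * y₂₄ + x₁ * y₂₃ + y₁₂ * y₃₄ := by
      rw [hm]
      linear_combination h₁₂ + h₁₃ + h₁₄ + h₂₃ + h₂₄ + h₃₄ + h₁ + h₂ + h₃ + h₄ + hw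
    rw [this, hN]
    linarith [amgm x₁ x₂, amgm x₁ x₃, amgm x₁ x₄, amgm x₂ x₃, amgm x₂ x₄, amgm x₃ x₄, amgm x₂ y₃₄,
      amgm x₁ y₃₄, amgm x₁ y₂₄, amgm x₁ y₂₃, amgm y₁₂ y₃₄, sq_nonneg y₁₃, sq_nonneg y₁₄,
      sq_nonneg z₁, sq_nonneg z₂, sq_nonneg z₃, sq_nonneg z₄, sq_nonneg w, sq_nonneg y₂₃,
      sq_nonneg y₂₄, sq_nonneg y₃₄, sq_nonneg y₁₂, sq_nonneg x₁, sq_nonneg x₂, sq_nonneg x₃,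
      sq_nonneg x₄]
  have hN0 : 0 ≤ N := by rw [hN]; positivity
  clear_value N m
  have e : (A + m / 16) ^ 2 = A ^ 2 + A * m / 8 + m ^ 2 / 256 := by ring
  linarith

theorem sum_not_exactlyOne_le {x₁ x₂ x₃ x₄ : Bool → ℝ} (h₁ : ∀ u, 0 ≤ x₁ u) (h₂ : ∀ u, 0 ≤ x₂ u)
    (h₃ : ∀ u, 0 ≤ x₃ u) (h₄ : ∀ u, 0 ≤ x₄ u) :
    ∑ u₁ : Bool, ∑ u₂ : Bool, ∑ u₃ : Bool, ∑ u₄ : Bool,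
      (if exactlyOne u₁ u₂ u₃ u₄ then 0 else x₁ u₁ * x₂ u₂ * x₃ u₃ * x₄ u₄) ≤
    √(x₁ false ^ 2 + 16 * x₁ true ^ 2) * √(x₂ false ^ 2 + 16 * x₂ true ^ 2) *
      √(x₃ false ^ 2 + 16 * x₃ true ^ 2) * √(x₄ false ^ 2 + 16 * x₄ true ^ 2) := by
  rw [← Real.sqrt_mul (by positivity), ← Real.sqrt_mul (by positivity),
    ← Real.sqrt_mul (by positivity)]
  refine Real.le_sqrt_of_sq_le ?_
  simp only [Fintype.sum_bool, exactlyOne]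
  simp only [Bool.not_true, Bool.not_false, Bool.and_true, Bool.and_false, Bool.or_true,
    Bool.or_false, Bool.false_eq_true, if_true, if_false]
  have ha₁ := h₁ false
  have hb₁ := h₁ true
  have ha₂ := h₂ false
  have hb₂ := h₂ true
  have ha₃ := h₃ false
  have hb₃ := h₃ true
  have ha₄ := h₄ false
  have hb₄ := h₄ true
  generalize x₁ false = a₁ at *
  generalize x₁ true = b₁ at *
  generalize x₂ false = a₂ at *
  generalize x₂ true = b₂ at *
  generalize x₃ false = a₃ at *
  generalize x₃ true = b₃ at *
  generalize x₄ false = a₄ at *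
  generalize x₄ true = b₄ at *
  have key := sq_add_sum_le (A := a₁ * a₂ * a₃ * a₄)
    (x₁ := 4 * b₁ * a₂ * a₃ * a₄) (x₂ := a₁ * (4 * b₂) * a₃ * a₄)
    (x₃ := a₁ * a₂ * (4 * b₃) * a₄) (x₄ := a₁ * a₂ * a₃ * (4 * b₄))
    (y₁₂ := (4 * b₁) * (4 * b₂) * a₃ * a₄) (y₁₃ := (4 * b₁) * a₂ * (4 * b₃) * a₄)
    (y₁₄ := (4 * b₁) * a₂ * a₃ * (4 * b₄)) (y₂₃ := a₁ * (4 * b₂) * (4 * b₃) * a₄)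
    (y₂₄ := a₁ * (4 * b₂) * a₃ * (4 * b₄)) (y₃₄ := a₁ * a₂ * (4 * b₃) * (4 * b₄))
    (z₁ := a₁ * (4 * b₂) * (4 * b₃) * (4 * b₄)) (z₂ := (4 * b₁) * a₂ * (4 * b₃) * (4 * b₄))
    (z₃ := (4 * b₁) * (4 * b₂) * a₃ * (4 * b₄)) (z₄ := (4 * b₁) * (4 * b₂) * (4 * b₃) * a₄)
    (w := (4 * b₁) * (4 * b₂) * (4 * b₃) * (4 * b₄)) (by ring) (by ring) (by ring) (by ring)
    (by ring) (by ring) (by ring) (by ring) (by ring) (by ring) (by ring)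
  refine le_trans (pow_le_pow_left₀ (by positivity) ?_ 2) (key.trans (le_of_eq (by ring)))
  have p₁ : 0 ≤ a₁ * b₂ * b₃ * b₄ := by positivity
  have p₂ : 0 ≤ b₁ * a₂ * b₃ * b₄ := by positivity
  have p₃ : 0 ≤ b₁ * b₂ * a₃ * b₄ := by positivity
  have p₄ : 0 ≤ b₁ * b₂ * b₃ * a₄ := by positivity
  have p₅ : 0 ≤ b₁ * b₂ * b₃ * b₄ := by positivity
  linarith

theorem sum_four_powerset_insertIf {a : α} {s : Finset α} (ha : a ∉ s)
    (F : Finset α → Finset α → Finset α → Finset α → ℝ) :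
    ∑ J₁ ∈ (insert a s).powerset, ∑ J₂ ∈ (insert a s).powerset, ∑ J₃ ∈ (insert a s).powerset,
      ∑ J₄ ∈ (insert a s).powerset, F J₁ J₂ J₃ J₄ =
    ∑ u₁ : Bool, ∑ u₂ : Bool, ∑ u₃ : Bool, ∑ u₄ : Bool, ∑ J₁ ∈ s.powerset, ∑ J₂ ∈ s.powerset,
      ∑ J₃ ∈ s.powerset, ∑ J₄ ∈ s.powerset,
        F (insertIf a u₁ J₁) (insertIf a u₂ J₂) (insertIf a u₃ J₃) (insertIf a u₄ J₄) := by
  simp only [sum_powerset_insertIf ha, Fintype.sum_bool, Finset.sum_add_distrib]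

theorem sum_doublyCovered_powerset_le (s : Finset α) : ∀ g₁ g₂ g₃ g₄ : Finset α → ℝ,
    (∀ t, 0 ≤ g₁ t) → (∀ t, 0 ≤ g₂ t) → (∀ t, 0 ≤ g₃ t) → (∀ t, 0 ≤ g₄ t) →
    ∑ J₁ ∈ s.powerset, ∑ J₂ ∈ s.powerset, ∑ J₃ ∈ s.powerset, ∑ J₄ ∈ s.powerset,
      (if DoublyCovered J₁ J₂ J₃ J₄ then g₁ J₁ * g₂ J₂ * g₃ J₃ * g₄ J₄ else 0) ≤
    weightedNorm s g₁ * weightedNorm s g₂ * weightedNorm s g₃ * weightedNorm s g₄ := by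
  induction s using Finset.induction_on with
  | empty =>
    intro g₁ g₂ g₃ g₄ h₁ h₂ h₃ h₄
    simp [weightedNorm, DoublyCovered, Real.sqrt_sq, h₁ ∅, h₂ ∅, h₃ ∅, h₄ ∅]
  | insert a s ha ih =>
    intro g₁ g₂ g₃ g₄ h₁ h₂ h₃ h₄
    simp only [weightedNorm_insert ha]
    rw [sum_four_powerset_insertIf ha]
    refine le_trans (Finset.sum_le_sum fun u₁ _ => Finset.sum_le_sum fun u₂ _ =>
      Finset.sum_le_sum fun u₃ _ => Finset.sum_le_sum fun u₄ _ => ?_)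
      (sum_not_exactlyOne_le (x₁ := fun u => weightedNorm s (fun t => g₁ (insertIf a u t)))
        (x₂ := fun u => weightedNorm s (fun t => g₂ (insertIf a u t)))
        (x₃ := fun u => weightedNorm s (fun t => g₃ (insertIf a u t)))
        (x₄ := fun u => weightedNorm s (fun t => g₄ (insertIf a u t)))
        (fun _ => weightedNorm_nonneg _ _) (fun _ => weightedNorm_nonneg _ _)
        (fun _ => weightedNorm_nonneg _ _) (fun _ => weightedNorm_nonneg _ _))
    split_ifs with hu
    · refine le_of_eq (Finset.sum_eq_zero fun J₁ k₁ => Finset.sum_eq_zero fun J₂ k₂ =>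
        Finset.sum_eq_zero fun J₃ k₃ => Finset.sum_eq_zero fun J₄ k₄ => if_neg fun hc => ?_)
      rw [Finset.mem_powerset] at k₁ k₂ k₃ k₄
      have := (hc.of_insertIf ha k₁ k₂ k₃ k₄).1
      simp [hu] at this
    · refine le_trans (Finset.sum_le_sum fun J₁ k₁ => Finset.sum_le_sum fun J₂ k₂ =>
        Finset.sum_le_sum fun J₃ k₃ => Finset.sum_le_sum fun J₄ k₄ => ?_)
        (ih (fun t => g₁ (insertIf a u₁ t)) (fun t => g₂ (insertIf a u₂ t))
          (fun t => g₃ (insertIf a u₃ t)) (fun t => g₄ (insertIf a u₄ t))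
          (fun _ => h₁ _) (fun _ => h₂ _) (fun _ => h₃ _) (fun _ => h₄ _))
      rw [Finset.mem_powerset] at k₁ k₂ k₃ k₄
      by_cases c : DoublyCovered (insertIf a u₁ J₁) (insertIf a u₂ J₂) (insertIf a u₃ J₃)
        (insertIf a u₄ J₄) <;> beta_reduce
      · rw [if_pos c, if_pos (c.of_insertIf ha k₁ k₂ k₃ k₄).2]
      · rw [if_neg c]
        split_ifs
        exacts [mul_nonneg (mul_nonneg (mul_nonneg (h₁ _) (h₂ _)) (h₃ _)) (h₄ _), le_rfl]

/-- A Finner-type inequality: a sum over quadruples of `q`-sets in which every element is covered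
at least twice is controlled by the product of the `ℓ²` norms. -/
theorem sum_doublyCovered_le {q : ℕ} {F : Finset (Finset α)} (hF : ∀ J ∈ F, J.card = q)
    {g₁ g₂ g₃ g₄ : Finset α → ℝ}
    (h₁ : ∀ t, 0 ≤ g₁ t) (h₂ : ∀ t, 0 ≤ g₂ t) (h₃ : ∀ t, 0 ≤ g₃ t) (h₄ : ∀ t, 0 ≤ g₄ t) :
    ∑ J₁ ∈ F, ∑ J₂ ∈ F, ∑ J₃ ∈ F, ∑ J₄ ∈ F,
      (if DoublyCovered J₁ J₂ J₃ J₄ then g₁ J₁ * g₂ J₂ * g₃ J₃ * g₄ J₄ else 0) ≤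
    256 ^ q * (√(∑ J ∈ F, g₁ J ^ 2) * √(∑ J ∈ F, g₂ J ^ 2) * √(∑ J ∈ F, g₃ J ^ 2) *
      √(∑ J ∈ F, g₄ J ^ 2)) := by
  set s : Finset α := F.biUnion id with hs
  have hsub : F ⊆ s.powerset := fun J hJ =>
    Finset.mem_powerset.2 (Finset.subset_biUnion_of_mem id hJ)
  have hsum : ∀ f : Finset α → ℝ,
      ∑ J ∈ s.powerset, (if J ∈ F then f J else 0) = ∑ J ∈ F, f J := fun f => by
    rw [Finset.sum_ite_mem, Finset.inter_eq_right.2 hsub]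
  have hnorm : ∀ g : Finset α → ℝ, weightedNorm s (fun J => if J ∈ F then g J else 0) =
      4 ^ q * √(∑ J ∈ F, g J ^ 2) := fun g => by
    have e : ∑ t ∈ s.powerset, 16 ^ t.card * (if t ∈ F then g t else 0) ^ 2 =
        (4 ^ q) ^ 2 * ∑ J ∈ F, g J ^ 2 := by
      rw [Finset.mul_sum, ← hsum]
      refine Finset.sum_congr rfl fun t _ => ?_
      split_ifs with ht
      · rw [hF t ht, ← pow_mul, mul_comm q 2, pow_mul]
        norm_num
      · simp
    rw [weightedNorm, e, Real.sqrt_mul (by positivity), Real.sqrt_sq (by positivity)]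
  have key := sum_doublyCovered_powerset_le s (fun J => if J ∈ F then g₁ J else 0)
    (fun J => if J ∈ F then g₂ J else 0) (fun J => if J ∈ F then g₃ J else 0)
    (fun J => if J ∈ F then g₄ J else 0)
    (fun t => by split_ifs; exacts [h₁ t, le_rfl]) (fun t => by split_ifs; exacts [h₂ t, le_rfl])
    (fun t => by split_ifs; exacts [h₃ t, le_rfl]) (fun t => by split_ifs; exacts [h₄ t, le_rfl])
  simp only [hnorm] at key
  have e256 : (256 : ℝ) ^ q = 4 ^ q * 4 ^ q * 4 ^ q * 4 ^ q := by
    rw [← mul_pow, ← mul_pow, ← mul_pow]; norm_num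
  refine le_trans (le_of_eq ?_) (key.trans (le_of_eq (by rw [e256]; ring)))
  rw [← hsum]
  refine Finset.sum_congr rfl fun J₁ _ => ?_
  split_ifs with k₁
  swap
  · simp
  rw [← hsum]
  refine Finset.sum_congr rfl fun J₂ _ => ?_
  split_ifs with k₂
  swap
  · simp
  rw [← hsum]
  refine Finset.sum_congr rfl fun J₃ _ => ?_
  split_ifs with k₃
  swap
  · simp
  rw [← hsum]
  refine Finset.sum_congr rfl fun J₄ _ => ?_
  split_ifs with k₄ <;> simp

end Covering

section Overlap
variable {α : Type*} [DecidableEq α]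

/-- The total squared weight of the sets of `F` containing `i`. -/
noncomputable def influence (F : Finset (Finset α)) (a : Finset α → ℝ) (i : α) : ℝ :=
  ∑ J ∈ F, if i ∈ J then a J ^ 2 else 0

/-- Two disjoint members of `F` whose union splits into two other members of `F`. -/
def Recombinable (F : Finset (Finset α)) (J L : Finset α) : Prop :=
  J ∩ L = ∅ ∧ ∃ k ∈ F, ∃ l ∈ F, k ∪ l = J ∪ L ∧ k ≠ J ∧ k ≠ L

/-- The quadruples which contribute to the fluctuation of the squared sum: each half overlaps,
every element is covered twice, and the quadruple is not a pair of disjoint doubled sets. -/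
def Fluctuating (J₁ J₂ J₃ J₄ : Finset α) : Prop :=
  DoublyCovered J₁ J₂ J₃ J₄ ∧ (J₁ ∩ J₂).Nonempty ∧ (J₃ ∩ J₄).Nonempty ∧
    ¬ (J₁ = J₂ ∧ J₃ = J₄ ∧ Disjoint J₁ J₃)

theorem influence_nonneg (F : Finset (Finset α)) (a : Finset α → ℝ) (i : α) :
    0 ≤ influence F a i :=
  Finset.sum_nonneg fun J _ => by split_ifs <;> positivity

theorem sum_influence {q : ℕ} {F : Finset (Finset α)} (hF : ∀ J ∈ F, J.card = q)
    (a : Finset α → ℝ) :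
    ∑ i ∈ F.biUnion id, influence F a i = q * ∑ J ∈ F, a J ^ 2 := by
  unfold influence
  rw [Finset.sum_comm, Finset.mul_sum]
  refine Finset.sum_congr rfl fun J hJ => ?_
  have hsub : J ⊆ F.biUnion id := Finset.subset_biUnion_of_mem id hJ
  rw [Finset.sum_ite_mem, Finset.inter_eq_right.2 hsub, Finset.sum_const, nsmul_eq_mul]
  simp [hF J hJ]

theorem sum_intersecting_le {F : Finset (Finset α)} {a : Finset α → ℝ} :
    ∑ J ∈ F, ∑ L ∈ F, (if (J ∩ L).Nonempty then a J ^ 2 * a L ^ 2 else 0) ≤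
      ∑ i ∈ F.biUnion id, influence F a i ^ 2 := by
  have e : ∀ i, influence F a i ^ 2 =
      ∑ J ∈ F, ∑ L ∈ F, (if i ∈ J ∩ L then a J ^ 2 * a L ^ 2 else 0) := fun i => by
    rw [pow_two, influence, Finset.sum_mul_sum]
    refine Finset.sum_congr rfl fun J _ => Finset.sum_congr rfl fun L _ => ?_
    by_cases h : i ∈ J <;> by_cases h' : i ∈ L <;> simp [h, h']
  simp only [e]
  rw [Finset.sum_comm (s := F.biUnion id)]
  refine Finset.sum_le_sum fun J hJ => ?_
  rw [Finset.sum_comm]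
  refine Finset.sum_le_sum fun L hL => ?_
  split_ifs with h
  · obtain ⟨i, hi⟩ := h
    refine le_trans (le_of_eq (if_pos hi).symm)
      (Finset.single_le_sum (f := fun i => if i ∈ J ∩ L then a J ^ 2 * a L ^ 2 else 0)
        (fun i _ => by split_ifs <;> positivity)
        (Finset.mem_biUnion.2 ⟨J, hJ, (Finset.mem_inter.1 hi).1⟩))
  · exact Finset.sum_nonneg fun i _ => by split_ifs <;> positivity

theorem sum_sum_eq_le_mul {ι κ δ : Type*} [DecidableEq κ] [DecidableEq δ] {P : Finset ι}
    {c : ι → ℝ} (key : ι → κ) (φ : κ → δ) {N : ℕ}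
    (hN : ∀ d, ((P.image key).filter (fun k => φ k = d)).card ≤ N) :
    ∑ p ∈ P, ∑ r ∈ P, (if φ (key p) = φ (key r) then c p * c r else 0) ≤
      N * ∑ p ∈ P, ∑ r ∈ P, (if key p = key r then c p * c r else 0) := by
  set f : κ → ℝ := fun k => ∑ p ∈ P, if key p = k then c p else 0 with hf
  have hker : ∀ (R : κ → κ → Prop) [DecidableRel R],
      ∑ p ∈ P, ∑ r ∈ P, (if R (key p) (key r) then c p * c r else 0) =
      ∑ k ∈ P.image key, ∑ l ∈ P.image key, (if R k l then f k * f l else 0) := fun R _ => by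
    have h1 : ∀ G : ι → κ → ℝ, ∑ p ∈ P, G p (key p) =
        ∑ k ∈ P.image key, ∑ p ∈ P, if key p = k then G p k else 0 := fun G => by
      rw [Finset.sum_comm]
      refine Finset.sum_congr rfl fun p hp => ?_
      rw [Finset.sum_ite_eq, if_pos (Finset.mem_image_of_mem key hp)]
    rw [h1 (fun p k => ∑ r ∈ P, (if R k (key r) then c p * c r else 0))]
    refine Finset.sum_congr rfl fun k _ => ?_
    have h2 : ∀ p, ∑ r ∈ P, (if R k (key r) then c p * c r else 0) =
        ∑ l ∈ P.image key, ∑ r ∈ P, if key r = l then (if R k l then c p * c r else 0) else 0 :=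
      fun p => h1 (fun r l => if R k l then c p * c r else 0)
    simp only [h2]
    have h3 : ∀ p, (if key p = k then ∑ l ∈ P.image key, ∑ r ∈ P,
        (if key r = l then (if R k l then c p * c r else 0) else 0) else 0) =
        ∑ l ∈ P.image key, (if key p = k then ∑ r ∈ P,
        (if key r = l then (if R k l then c p * c r else 0) else 0) else 0) := fun p => by
      split_ifs <;> simp
    simp only [h3]
    rw [Finset.sum_comm]
    refine Finset.sum_congr rfl fun l _ => ?_
    split_ifs with hR
    · rw [hf]
      simp only
      rw [Finset.sum_mul_sum]
      refine Finset.sum_congr rfl fun p _ => ?_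
      by_cases h : key p = k
      · simp only [h, if_true]
        refine Finset.sum_congr rfl fun r _ => ?_
        split_ifs <;> simp
      · simp [h]
    · simp
  rw [hker (fun k l => φ k = φ l), hker (fun k l => k = l)]
  have hsq : ∀ k ∈ P.image key, ∑ l ∈ P.image key, (if k = l then f k * f l else 0) = f k ^ 2 :=
    fun k hk => by
      rw [Finset.sum_ite_eq, if_pos hk, pow_two]
  rw [Finset.sum_congr rfl hsq]
  calc ∑ k ∈ P.image key, ∑ l ∈ P.image key, (if φ k = φ l then f k * f l else 0)
      ≤ ∑ k ∈ P.image key, ∑ l ∈ P.image key,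
        ((if φ k = φ l then f k ^ 2 / 2 else 0) + (if φ k = φ l then f l ^ 2 / 2 else 0)) := by
        refine Finset.sum_le_sum fun k _ => Finset.sum_le_sum fun l _ => ?_
        split_ifs
        · nlinarith [sq_nonneg (f k - f l)]
        · simp
    _ = ∑ k ∈ P.image key, ∑ l ∈ P.image key, (if φ k = φ l then f k ^ 2 else 0) := by
        simp only [Finset.sum_add_distrib]
        rw [Finset.sum_comm (f := fun k l => if φ k = φ l then f l ^ 2 / 2 else 0),
          ← Finset.sum_add_distrib]
        refine Finset.sum_congr rfl fun k _ => ?_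
        rw [← Finset.sum_add_distrib]
        refine Finset.sum_congr rfl fun l _ => ?_
        by_cases h : φ k = φ l
        · rw [if_pos h, if_pos h.symm, if_pos h]; ring
        · rw [if_neg h, if_neg (Ne.symm h), if_neg h]; ring
    _ ≤ ∑ k ∈ P.image key, N * f k ^ 2 := by
        refine Finset.sum_le_sum fun k _ => ?_
        rw [← Finset.sum_filter, Finset.sum_const, nsmul_eq_mul]
        refine mul_le_mul_of_nonneg_right ?_ (sq_nonneg _)
        have := hN (φ k)
        simp only [eq_comm (a := φ k)]
        exact_mod_cast this
    _ = _ := by rw [Finset.mul_sum]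

end Overlap

section Fluctuation
variable {α : Type*} [DecidableEq α]

theorem card_filter_subset_union_le {q : ℕ} {F : Finset (Finset α)} (hF : ∀ J ∈ F, J.card = q)
    {J L : Finset α} (hJ : J ∈ F) (hL : L ∈ F) :
    ((F.filter (fun k => k ⊆ J ∪ L)).card : ℝ) ≤ 4 ^ q := by
  have h1 : F.filter (fun k => k ⊆ J ∪ L) ⊆ (J ∪ L).powerset := fun k hk =>
    Finset.mem_powerset.2 (Finset.mem_filter.1 hk).2
  have h2 : (J ∪ L).card ≤ 2 * q := by
    have := Finset.card_union_le J L
    rw [hF J hJ, hF L hL] at this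
    omega
  have h3 : (F.filter (fun k => k ⊆ J ∪ L)).card ≤ 4 ^ q := by
    refine (Finset.card_le_card h1).trans ?_
    rw [Finset.card_powerset]
    refine (Nat.pow_le_pow_right (by norm_num) h2).trans ?_
    rw [pow_mul]
    norm_num
  exact_mod_cast h3

theorem sum_key_eq_le {q : ℕ} {F : Finset (Finset α)} (hF : ∀ J ∈ F, J.card = q)
    {a : Finset α → ℝ}
    (hmul : ∀ J₁ J₂ J₃ J₄ : Finset α, J₁ \ J₂ = J₃ \ J₄ → J₂ \ J₁ = J₄ \ J₃ →
      a J₁ * a J₄ = a J₂ * a J₃) :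
    ∑ J₁ ∈ F, ∑ J₂ ∈ F, ∑ J₃ ∈ F, ∑ J₄ ∈ F,
      (if (J₁ ≠ J₂ ∧ (J₁ ∩ J₂).Nonempty) ∧ J₁ \ J₂ = J₃ \ J₄ ∧ J₂ \ J₁ = J₄ \ J₃ then
        (|a J₁| * |a J₂|) * (|a J₃| * |a J₄|) else 0) ≤
    16 ^ q * ((∑ J ∈ F, ∑ L ∈ F, (if Recombinable F J L then a J ^ 2 * a L ^ 2 else 0)) +
      ∑ i ∈ F.biUnion id, influence F a i ^ 2) := by
  set R : Finset α → Finset α → ℝ := fun J L =>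
    (if Recombinable F J L then a J ^ 2 * a L ^ 2 else 0) +
      (if (J ∩ L).Nonempty then a J ^ 2 * a L ^ 2 else 0) with hR
  have hR0 : ∀ J L, 0 ≤ R J L := fun J L => by
    rw [hR]; beta_reduce
    refine add_nonneg ?_ ?_ <;> (split_ifs <;> positivity)
  calc _ ≤ ∑ J₁ ∈ F, ∑ J₂ ∈ F, ∑ J₃ ∈ F, ∑ J₄ ∈ F,
        (if J₂ ⊆ J₁ ∪ J₄ then (if J₃ ⊆ J₁ ∪ J₄ then R J₁ J₄ else 0) else 0) := by
        refine Finset.sum_le_sum fun J₁ h₁ => Finset.sum_le_sum fun J₂ h₂ =>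
          Finset.sum_le_sum fun J₃ h₃ => Finset.sum_le_sum fun J₄ h₄ => ?_
        by_cases h : (J₁ ≠ J₂ ∧ (J₁ ∩ J₂).Nonempty) ∧ J₁ \ J₂ = J₃ \ J₄ ∧ J₂ \ J₁ = J₄ \ J₃
        swap
        · rw [if_neg h]
          split_ifs
          exacts [hR0 _ _, le_rfl, le_rfl]
        rw [if_pos h]
        obtain ⟨⟨hne, h_int⟩, e₁, e₂⟩ := h
        have m₁ : ∀ x, (x ∈ J₁ ∧ x ∉ J₂) ↔ (x ∈ J₃ ∧ x ∉ J₄) := fun x => by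
          rw [← Finset.mem_sdiff, ← Finset.mem_sdiff, e₁]
        have m₂ : ∀ x, (x ∈ J₂ ∧ x ∉ J₁) ↔ (x ∈ J₄ ∧ x ∉ J₃) := fun x => by
          rw [← Finset.mem_sdiff, ← Finset.mem_sdiff, e₂]
        have s₂ : J₂ ⊆ J₁ ∪ J₄ := fun x hx => by
          have := m₂ x
          rw [Finset.mem_union]; tauto
        have s₃ : J₃ ⊆ J₁ ∪ J₄ := fun x hx => by
          have := m₁ x
          rw [Finset.mem_union]; tauto
        rw [if_pos s₂, if_pos s₃]
        have hval : (|a J₁| * |a J₂|) * (|a J₃| * |a J₄|) = a J₁ ^ 2 * a J₄ ^ 2 := by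
          have : (|a J₁| * |a J₂|) * (|a J₃| * |a J₄|) = |a J₁ * a J₄| * |a J₂ * a J₃| := by
            rw [abs_mul, abs_mul]; ring
          rw [this, ← hmul J₁ J₂ J₃ J₄ e₁ e₂, ← pow_two, sq_abs, mul_pow]
        rw [hval, hR]
        beta_reduce
        by_cases hi : (J₁ ∩ J₄).Nonempty
        · rw [if_pos hi]
          refine le_add_of_nonneg_left ?_
          split_ifs <;> positivity
        · have hd : J₁ ∩ J₄ = ∅ := Finset.not_nonempty_iff_eq_empty.1 hi
          have hrec : Recombinable F J₁ J₄ := by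
            refine ⟨hd, J₂, h₂, J₃, h₃, ?_, hne.symm, ?_⟩
            · ext x
              have a₁ := m₁ x
              have a₂ := m₂ x
              have a₃ : ¬ (x ∈ J₁ ∧ x ∈ J₄) := fun h => by
                have := Finset.mem_inter.2 h
                rw [hd] at this
                exact absurd this (Finset.notMem_empty x)
              simp only [Finset.mem_union]; tauto
            · rintro rfl
              exact hi h_int
          rw [if_pos hrec]
          refine le_add_of_nonneg_right ?_
          split_ifs
          positivity
    _ = ∑ J₁ ∈ F, ∑ J₄ ∈ F, ∑ J₂ ∈ F, ∑ J₃ ∈ F,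
        (if J₂ ⊆ J₁ ∪ J₄ then (if J₃ ⊆ J₁ ∪ J₄ then R J₁ J₄ else 0) else 0) := by
        refine Finset.sum_congr rfl fun J₁ _ => ?_
        rw [Finset.sum_comm (s := F) (t := F) (f := fun J₄ J₂ => ∑ J₃ ∈ F,
          (if J₂ ⊆ J₁ ∪ J₄ then (if J₃ ⊆ J₁ ∪ J₄ then R J₁ J₄ else 0) else 0))]
        refine Finset.sum_congr rfl fun J₂ _ => ?_
        rw [Finset.sum_comm]
    _ ≤ ∑ J₁ ∈ F, ∑ J₄ ∈ F, 16 ^ q * R J₁ J₄ := by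
        refine Finset.sum_le_sum fun J₁ h₁ => Finset.sum_le_sum fun J₄ h₄ => ?_
        have hc := card_filter_subset_union_le hF h₁ h₄
        have hin : ∀ x : ℝ, ∑ J ∈ F, (if J ⊆ J₁ ∪ J₄ then x else 0) =
            (F.filter (fun k => k ⊆ J₁ ∪ J₄)).card * x := fun x => by
          rw [← Finset.sum_filter, Finset.sum_const, nsmul_eq_mul]
        have hin' : ∀ J₂, ∑ J₃ ∈ F,
            (if J₂ ⊆ J₁ ∪ J₄ then (if J₃ ⊆ J₁ ∪ J₄ then R J₁ J₄ else 0) else 0) =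
            if J₂ ⊆ J₁ ∪ J₄ then (F.filter (fun k => k ⊆ J₁ ∪ J₄)).card * R J₁ J₄ else 0 :=
          fun J₂ => by
            split_ifs
            · exact hin _
            · simp
        simp only [hin', hin]
        have e16 : (16 : ℝ) ^ q = 4 ^ q * 4 ^ q := by rw [← mul_pow]; norm_num
        rw [e16, mul_assoc (4 ^ q : ℝ)]
        refine mul_le_mul hc (mul_le_mul_of_nonneg_right hc (hR0 _ _)) ?_ (by positivity)
        exact mul_nonneg (Nat.cast_nonneg _) (hR0 _ _)
    _ = 16 ^ q * ((∑ J ∈ F, ∑ L ∈ F, (if Recombinable F J L then a J ^ 2 * a L ^ 2 else 0)) +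
        ∑ J ∈ F, ∑ L ∈ F, (if (J ∩ L).Nonempty then a J ^ 2 * a L ^ 2 else 0)) := by
        simp only [← Finset.mul_sum, hR, Finset.sum_add_distrib]
    _ ≤ _ := by
        refine mul_le_mul_of_nonneg_left ?_ (by positivity)
        exact add_le_add_right sum_intersecting_le _

theorem sum_symmDiff_eq_le {q : ℕ} {F : Finset (Finset α)} (hF : ∀ J ∈ F, J.card = q)
    {a : Finset α → ℝ}
    (hmul : ∀ J₁ J₂ J₃ J₄ : Finset α, J₁ \ J₂ = J₃ \ J₄ → J₂ \ J₁ = J₄ \ J₃ →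
      a J₁ * a J₄ = a J₂ * a J₃) :
    ∑ J₁ ∈ F, ∑ J₂ ∈ F, ∑ J₃ ∈ F, ∑ J₄ ∈ F,
      (if (J₁ ≠ J₂ ∧ (J₁ ∩ J₂).Nonempty) ∧ (J₃ ≠ J₄ ∧ (J₃ ∩ J₄).Nonempty) ∧
          J₁ \ J₂ ∪ J₂ \ J₁ = J₃ \ J₄ ∪ J₄ \ J₃ then
        |a J₁| * |a J₂| * |a J₃| * |a J₄| else 0) ≤
    256 ^ q * ((∑ J ∈ F, ∑ L ∈ F, (if Recombinable F J L then a J ^ 2 * a L ^ 2 else 0)) +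
      ∑ i ∈ F.biUnion id, influence F a i ^ 2) := by
  set P : Finset (Finset α × Finset α) :=
    (F ×ˢ F).filter (fun p => p.1 ≠ p.2 ∧ (p.1 ∩ p.2).Nonempty) with hP
  have hN : ∀ d, ((P.image (fun p => (p.1 \ p.2, p.2 \ p.1))).filter
      (fun k => k.1 ∪ k.2 = d)).card ≤ 16 ^ q := fun d => by
    rcases ((P.image (fun p => (p.1 \ p.2, p.2 \ p.1))).filter
      (fun k => k.1 ∪ k.2 = d)).eq_empty_or_nonempty with h | ⟨k, hk⟩
    · rw [h]; simp
    · have hd : d.card ≤ 2 * q := by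
        obtain ⟨hk1, rfl⟩ := Finset.mem_filter.1 hk
        obtain ⟨p, hp, rfl⟩ := Finset.mem_image.1 hk1
        have hp' := Finset.mem_product.1 (Finset.mem_filter.1 hp).1
        have c1 := Finset.card_union_le (p.1 \ p.2) (p.2 \ p.1)
        have c2 := Finset.card_le_card (Finset.sdiff_subset (s := p.1) (t := p.2))
        have c3 := Finset.card_le_card (Finset.sdiff_subset (s := p.2) (t := p.1))
        rw [hF _ hp'.1] at c2
        rw [hF _ hp'.2] at c3
        simp only at c1 ⊢
        omega
      have hsub : (P.image (fun p => (p.1 \ p.2, p.2 \ p.1))).filter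
          (fun k => k.1 ∪ k.2 = d) ⊆ d.powerset ×ˢ d.powerset := fun k hk => by
        obtain ⟨-, rfl⟩ := Finset.mem_filter.1 hk
        exact Finset.mem_product.2 ⟨Finset.mem_powerset.2 Finset.subset_union_left,
          Finset.mem_powerset.2 Finset.subset_union_right⟩
      refine (Finset.card_le_card hsub).trans ?_
      rw [Finset.card_product, Finset.card_powerset, ← pow_add]
      refine (Nat.pow_le_pow_right (by norm_num) (show d.card + d.card ≤ 4 * q by omega)).trans ?_
      rw [pow_mul]
      norm_num
  have key := sum_sum_eq_le_mul (P := P) (c := fun p => |a p.1| * |a p.2|)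
    (fun p => (p.1 \ p.2, p.2 \ p.1)) (fun k => k.1 ∪ k.2) hN
  have hpairs : ∀ G : Finset α × Finset α → Finset α × Finset α → ℝ,
      ∑ p ∈ P, ∑ r ∈ P, G p r = ∑ J₁ ∈ F, ∑ J₂ ∈ F, ∑ J₃ ∈ F, ∑ J₄ ∈ F,
        if (J₁ ≠ J₂ ∧ (J₁ ∩ J₂).Nonempty) then
          (if (J₃ ≠ J₄ ∧ (J₃ ∩ J₄).Nonempty) then G (J₁, J₂) (J₃, J₄) else 0) else 0 := fun G => by
    rw [hP, Finset.sum_filter, Finset.sum_product]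
    refine Finset.sum_congr rfl fun J₁ _ => Finset.sum_congr rfl fun J₂ _ => ?_
    split_ifs with h
    · rw [Finset.sum_filter, Finset.sum_product]
    · simp
  rw [hpairs, hpairs] at key
  have e256 : (256 : ℝ) ^ q = 16 ^ q * 16 ^ q := by rw [← mul_pow]; norm_num
  rw [e256, mul_assoc]
  refine le_trans (le_of_eq ?_) (key.trans ?_)
  · refine Finset.sum_congr rfl fun J₁ _ => Finset.sum_congr rfl fun J₂ _ =>
      Finset.sum_congr rfl fun J₃ _ => Finset.sum_congr rfl fun J₄ _ => ?_
    dsimp only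
    split_ifs <;> first | (exfalso; tauto) | ring1
  · push_cast
    refine mul_le_mul_of_nonneg_left ?_ (by positivity)
    refine le_trans ?_ (sum_key_eq_le hF hmul)
    refine Finset.sum_le_sum fun J₁ _ => Finset.sum_le_sum fun J₂ _ =>
      Finset.sum_le_sum fun J₃ _ => Finset.sum_le_sum fun J₄ _ => ?_
    simp only [Prod.mk.injEq]
    split_ifs
    any_goals positivity
    · exact le_rfl
    · exfalso; tauto

theorem Fluctuating.cases {J₁ J₂ J₃ J₄ : Finset α} (h : Fluctuating J₁ J₂ J₃ J₄) :
    (∃ i, (i ∈ J₁ ∧ i ∈ J₂ ∧ i ∈ J₃) ∨ (i ∈ J₁ ∧ i ∈ J₂ ∧ i ∈ J₄) ∨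
      (i ∈ J₁ ∧ i ∈ J₃ ∧ i ∈ J₄) ∨ (i ∈ J₂ ∧ i ∈ J₃ ∧ i ∈ J₄)) ∨
    ((J₁ ≠ J₂ ∧ (J₁ ∩ J₂).Nonempty) ∧ (J₃ ≠ J₄ ∧ (J₃ ∩ J₄).Nonempty) ∧
      J₁ \ J₂ ∪ J₂ \ J₁ = J₃ \ J₄ ∪ J₄ \ J₃) := by
  obtain ⟨⟨c₁, c₂, c₃, c₄⟩, n₁, n₂, hn⟩ := h
  by_cases hex : ∃ i, (i ∈ J₁ ∧ i ∈ J₂ ∧ i ∈ J₃) ∨ (i ∈ J₁ ∧ i ∈ J₂ ∧ i ∈ J₄) ∨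
      (i ∈ J₁ ∧ i ∈ J₃ ∧ i ∈ J₄) ∨ (i ∈ J₂ ∧ i ∈ J₃ ∧ i ∈ J₄)
  · exact Or.inl hex
  right
  have hno : ∀ i, ¬ ((i ∈ J₁ ∧ i ∈ J₂ ∧ i ∈ J₃) ∨ (i ∈ J₁ ∧ i ∈ J₂ ∧ i ∈ J₄) ∨
      (i ∈ J₁ ∧ i ∈ J₃ ∧ i ∈ J₄) ∨ (i ∈ J₂ ∧ i ∈ J₃ ∧ i ∈ J₄)) := fun i hi => hex ⟨i, hi⟩
  simp only [Finset.subset_iff, Finset.mem_union] at c₁ c₂ c₃ c₄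
  have hsymm : J₁ \ J₂ ∪ J₂ \ J₁ = J₃ \ J₄ ∪ J₄ \ J₃ := by
    ext x
    have d₁ := @c₁ x
    have d₂ := @c₂ x
    have d₃ := @c₃ x
    have d₄ := @c₄ x
    have d := hno x
    clear c₁ c₂ c₃ c₄ hno n₁ n₂ hn hex
    simp only [Finset.mem_union, Finset.mem_sdiff]
    by_cases h₁ : x ∈ J₁ <;> by_cases h₂ : x ∈ J₂ <;> by_cases h₃ : x ∈ J₃ <;>
      by_cases h₄ : x ∈ J₄ <;> simp [h₁, h₂, h₃, h₄] at d₁ d₂ d₃ d₄ d ⊢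
  have hiff : J₁ = J₂ ↔ J₃ = J₄ := by
    have e : ∀ A B : Finset α, A = B ↔ A \ B ∪ B \ A = ∅ := fun A B => by
      rw [Finset.union_eq_empty, Finset.sdiff_eq_empty_iff_subset,
        Finset.sdiff_eq_empty_iff_subset]
      exact ⟨fun h => h ▸ ⟨subset_rfl, subset_rfl⟩, fun h => h.1.antisymm h.2⟩
    rw [e J₁, e J₃, hsymm]
  have hne : J₁ ≠ J₂ := fun h12 => by
    refine hn ⟨h12, hiff.1 h12, ?_⟩
    rw [Finset.disjoint_left]
    intro x hx hx'
    exact hno x (Or.inl ⟨hx, h12 ▸ hx, hx'⟩)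
  exact ⟨⟨hne, n₁⟩, ⟨fun h => hne (hiff.2 h), n₂⟩, hsymm⟩

theorem sum_fluctuating_le {q : ℕ} {F : Finset (Finset α)} (hF : ∀ J ∈ F, J.card = q)
    {a : Finset α → ℝ} {τ : ℝ} (hsum : ∑ J ∈ F, a J ^ 2 = 1)
    (hmul : ∀ J₁ J₂ J₃ J₄ : Finset α, J₁ \ J₂ = J₃ \ J₄ → J₂ \ J₁ = J₄ \ J₃ →
      a J₁ * a J₄ = a J₂ * a J₃) (hτ : ∀ i, influence F a i ≤ τ) :
    ∑ J₁ ∈ F, ∑ J₂ ∈ F, ∑ J₃ ∈ F, ∑ J₄ ∈ F,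
      (if Fluctuating J₁ J₂ J₃ J₄ then |a J₁| * |a J₂| * |a J₃| * |a J₄| else 0) ≤
    256 ^ q * (4 * q * √τ +
      ((∑ J ∈ F, ∑ L ∈ F, (if Recombinable F J L then a J ^ 2 * a L ^ 2 else 0)) + q * τ)) := by
  set s : Finset α := F.biUnion id with hs
  set r : α → Finset α → ℝ := fun i J => if i ∈ J then |a J| else 0 with hr
  have hr0 : ∀ i J, 0 ≤ r i J := fun i J => by rw [hr]; beta_reduce; split_ifs <;> positivity
  have hr1 : ∀ i, √(∑ J ∈ F, r i J ^ 2) = √(influence F a i) := fun i => by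
    congr 1
    refine Finset.sum_congr rfl fun J _ => ?_
    rw [hr]; beta_reduce
    split_ifs <;> simp
  have hr2 : √(∑ J ∈ F, |a J| ^ 2) = 1 := by simp [sq_abs, hsum]
  set T : (Finset α → ℝ) → (Finset α → ℝ) → (Finset α → ℝ) → (Finset α → ℝ) →
      Finset α → Finset α → Finset α → Finset α → ℝ := fun g₁ g₂ g₃ g₄ J₁ J₂ J₃ J₄ =>
    if DoublyCovered J₁ J₂ J₃ J₄ then g₁ J₁ * g₂ J₂ * g₃ J₃ * g₄ J₄ else 0 with hT
  have hT0 : ∀ g₁ g₂ g₃ g₄ : Finset α → ℝ, (∀ t, 0 ≤ g₁ t) → (∀ t, 0 ≤ g₂ t) → (∀ t, 0 ≤ g₃ t) →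
      (∀ t, 0 ≤ g₄ t) → ∀ J₁ J₂ J₃ J₄, 0 ≤ T g₁ g₂ g₃ g₄ J₁ J₂ J₃ J₄ := by
    intro g₁ g₂ g₃ g₄ h₁ h₂ h₃ h₄ J₁ J₂ J₃ J₄
    rw [hT]; beta_reduce
    split_ifs
    exacts [mul_nonneg (mul_nonneg (mul_nonneg (h₁ _) (h₂ _)) (h₃ _)) (h₄ _), le_rfl]
  set A : Finset α → ℝ := fun J => |a J| with hA
  have hA0 : ∀ J, 0 ≤ A J := fun J => abs_nonneg _
  set U : α → Finset α → Finset α → Finset α → Finset α → ℝ := fun i J₁ J₂ J₃ J₄ =>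
    T (r i) (r i) (r i) A J₁ J₂ J₃ J₄ + T (r i) (r i) A (r i) J₁ J₂ J₃ J₄ +
      T (r i) A (r i) (r i) J₁ J₂ J₃ J₄ + T A (r i) (r i) (r i) J₁ J₂ J₃ J₄ with hU
  have t₁ : ∀ i J₁ J₂ J₃ J₄, 0 ≤ T (r i) (r i) (r i) A J₁ J₂ J₃ J₄ := fun i =>
    hT0 _ _ _ _ (hr0 i) (hr0 i) (hr0 i) hA0
  have t₂ : ∀ i J₁ J₂ J₃ J₄, 0 ≤ T (r i) (r i) A (r i) J₁ J₂ J₃ J₄ := fun i =>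
    hT0 _ _ _ _ (hr0 i) (hr0 i) hA0 (hr0 i)
  have t₃ : ∀ i J₁ J₂ J₃ J₄, 0 ≤ T (r i) A (r i) (r i) J₁ J₂ J₃ J₄ := fun i =>
    hT0 _ _ _ _ (hr0 i) hA0 (hr0 i) (hr0 i)
  have t₄ : ∀ i J₁ J₂ J₃ J₄, 0 ≤ T A (r i) (r i) (r i) J₁ J₂ J₃ J₄ := fun i =>
    hT0 _ _ _ _ hA0 (hr0 i) (hr0 i) (hr0 i)
  have hU0 : ∀ i J₁ J₂ J₃ J₄, 0 ≤ U i J₁ J₂ J₃ J₄ := fun i J₁ J₂ J₃ J₄ =>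
    add_nonneg (add_nonneg (add_nonneg (t₁ i _ _ _ _) (t₂ i _ _ _ _)) (t₃ i _ _ _ _))
      (t₄ i _ _ _ _)
  have hpt : ∀ J₁ ∈ F, ∀ J₂ ∈ F, ∀ J₃ ∈ F, ∀ J₄ ∈ F,
      (if Fluctuating J₁ J₂ J₃ J₄ then |a J₁| * |a J₂| * |a J₃| * |a J₄| else 0) ≤
      (∑ i ∈ s, U i J₁ J₂ J₃ J₄) +
      (if (J₁ ≠ J₂ ∧ (J₁ ∩ J₂).Nonempty) ∧ (J₃ ≠ J₄ ∧ (J₃ ∩ J₄).Nonempty) ∧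
          J₁ \ J₂ ∪ J₂ \ J₁ = J₃ \ J₄ ∪ J₄ \ J₃ then
        |a J₁| * |a J₂| * |a J₃| * |a J₄| else 0) := by
    intro J₁ h₁ J₂ h₂ J₃ h₃ J₄ h₄
    have hsU : 0 ≤ ∑ i ∈ s, U i J₁ J₂ J₃ J₄ := Finset.sum_nonneg fun i _ => hU0 i _ _ _ _
    by_cases hfl : Fluctuating J₁ J₂ J₃ J₄
    swap
    · rw [if_neg hfl]
      refine add_nonneg hsU ?_
      split_ifs <;> positivity
    rw [if_pos hfl]
    have hdc := hfl.1
    rcases hfl.cases with ⟨i, hi⟩ | h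
    swap
    · rw [if_pos h]
      exact le_add_of_nonneg_left hsU
    refine le_add_of_le_of_nonneg ?_ (by split_ifs <;> positivity)
    have his : i ∈ s := by
      rcases hi with h | h | h | h
      · exact Finset.mem_biUnion.2 ⟨J₁, h₁, h.1⟩
      · exact Finset.mem_biUnion.2 ⟨J₁, h₁, h.1⟩
      · exact Finset.mem_biUnion.2 ⟨J₁, h₁, h.1⟩
      · exact Finset.mem_biUnion.2 ⟨J₂, h₂, h.1⟩
    refine le_trans ?_ (Finset.single_le_sum (f := fun i => U i J₁ J₂ J₃ J₄)
      (fun i _ => hU0 i _ _ _ _) his)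
    have u₁ := t₁ i J₁ J₂ J₃ J₄
    have u₂ := t₂ i J₁ J₂ J₃ J₄
    have u₃ := t₃ i J₁ J₂ J₃ J₄
    have u₄ := t₄ i J₁ J₂ J₃ J₄
    have hval : ∀ {J}, i ∈ J → r i J = |a J| := fun h => if_pos h
    rcases hi with ⟨m₁, m₂, m₃⟩ | ⟨m₁, m₂, m₃⟩ | ⟨m₁, m₂, m₃⟩ | ⟨m₁, m₂, m₃⟩
    · have : T (r i) (r i) (r i) A J₁ J₂ J₃ J₄ = |a J₁| * |a J₂| * |a J₃| * |a J₄| := by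
        rw [hT]; beta_reduce
        rw [if_pos hdc, hval m₁, hval m₂, hval m₃]
      simp only [hU]
      linarith
    · have : T (r i) (r i) A (r i) J₁ J₂ J₃ J₄ = |a J₁| * |a J₂| * |a J₃| * |a J₄| := by
        rw [hT]; beta_reduce
        rw [if_pos hdc, hval m₁, hval m₂, hval m₃]
      simp only [hU]
      linarith
    · have : T (r i) A (r i) (r i) J₁ J₂ J₃ J₄ = |a J₁| * |a J₂| * |a J₃| * |a J₄| := by
        rw [hT]; beta_reduce
        rw [if_pos hdc, hval m₁, hval m₂, hval m₃]
      simp only [hU]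
      linarith
    · have : T A (r i) (r i) (r i) J₁ J₂ J₃ J₄ = |a J₁| * |a J₂| * |a J₃| * |a J₄| := by
        rw [hT]; beta_reduce
        rw [if_pos hdc, hval m₁, hval m₂, hval m₃]
      simp only [hU]
      linarith
  have hUsum : ∀ i, ∑ J₁ ∈ F, ∑ J₂ ∈ F, ∑ J₃ ∈ F, ∑ J₄ ∈ F, U i J₁ J₂ J₃ J₄ ≤
      256 ^ q * (4 * √τ * influence F a i) := fun i => by
    have hi0 := influence_nonneg F a i
    have k₁ := sum_doublyCovered_le hF (hr0 i) (hr0 i) (hr0 i) hA0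
    have k₂ := sum_doublyCovered_le hF (hr0 i) (hr0 i) hA0 (hr0 i)
    have k₃ := sum_doublyCovered_le hF (hr0 i) hA0 (hr0 i) (hr0 i)
    have k₄ := sum_doublyCovered_le hF hA0 (hr0 i) (hr0 i) (hr0 i)
    rw [hr1, hA, hr2] at k₁ k₂ k₃ k₄
    have e : √(influence F a i) * √(influence F a i) * √(influence F a i) ≤
        √τ * influence F a i := by
      rw [Real.mul_self_sqrt hi0, mul_comm]
      exact mul_le_mul_of_nonneg_right (Real.sqrt_le_sqrt (hτ i)) hi0
    have e' := mul_le_mul_of_nonneg_left e (show (0 : ℝ) ≤ 256 ^ q by positivity)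
    simp only [hU, hT, hA, Finset.sum_add_distrib]
    linarith
  have hq := sum_influence hF a
  rw [hsum, mul_one] at hq
  calc _ ≤ ∑ J₁ ∈ F, ∑ J₂ ∈ F, ∑ J₃ ∈ F, ∑ J₄ ∈ F, ((∑ i ∈ s, U i J₁ J₂ J₃ J₄) +
      (if (J₁ ≠ J₂ ∧ (J₁ ∩ J₂).Nonempty) ∧ (J₃ ≠ J₄ ∧ (J₃ ∩ J₄).Nonempty) ∧
          J₁ \ J₂ ∪ J₂ \ J₁ = J₃ \ J₄ ∪ J₄ \ J₃ then
        |a J₁| * |a J₂| * |a J₃| * |a J₄| else 0)) :=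
        Finset.sum_le_sum fun J₁ h₁ => Finset.sum_le_sum fun J₂ h₂ =>
          Finset.sum_le_sum fun J₃ h₃ => Finset.sum_le_sum fun J₄ h₄ => hpt J₁ h₁ J₂ h₂ J₃ h₃ J₄ h₄
    _ = (∑ i ∈ s, ∑ J₁ ∈ F, ∑ J₂ ∈ F, ∑ J₃ ∈ F, ∑ J₄ ∈ F, U i J₁ J₂ J₃ J₄) +
      ∑ J₁ ∈ F, ∑ J₂ ∈ F, ∑ J₃ ∈ F, ∑ J₄ ∈ F,
      (if (J₁ ≠ J₂ ∧ (J₁ ∩ J₂).Nonempty) ∧ (J₃ ≠ J₄ ∧ (J₃ ∩ J₄).Nonempty) ∧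
          J₁ \ J₂ ∪ J₂ \ J₁ = J₃ \ J₄ ∪ J₄ \ J₃ then
        |a J₁| * |a J₂| * |a J₃| * |a J₄| else 0) := by
        have hc : ∀ V : α → Finset α → ℝ, ∑ J ∈ F, ∑ i ∈ s, V i J = ∑ i ∈ s, ∑ J ∈ F, V i J :=
          fun V => Finset.sum_comm
        simp only [Finset.sum_add_distrib, hc]
    _ ≤ (∑ i ∈ s, 256 ^ q * (4 * √τ * influence F a i)) + 256 ^ q *
        ((∑ J ∈ F, ∑ L ∈ F, (if Recombinable F J L then a J ^ 2 * a L ^ 2 else 0)) +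
          ∑ i ∈ s, influence F a i ^ 2) :=
        add_le_add (Finset.sum_le_sum fun i _ => hUsum i) (sum_symmDiff_eq_le hF hmul)
    _ ≤ (∑ i ∈ s, 256 ^ q * (4 * √τ * influence F a i)) + 256 ^ q *
        ((∑ J ∈ F, ∑ L ∈ F, (if Recombinable F J L then a J ^ 2 * a L ^ 2 else 0)) +
          ∑ i ∈ s, influence F a i * τ) := by
        gcongr with i _
        rw [pow_two]
        exact mul_le_mul_of_nonneg_left (hτ i) (influence_nonneg F a i)
    _ = _ := by
        rw [← Finset.mul_sum, ← Finset.mul_sum, ← Finset.sum_mul, hq]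
        ring

end Fluctuation

section Moments
variable {α Ω : Type*} [MeasurableSpace Ω] {P : Measure Ω}
  {X : α → Ω → ℝ} {β : ℝ}

theorem integral_finset_prod_comp (hX : ∀ i, Measurable (X i)) (hind : iIndepFun X P)
    (s : Finset α) {f : α → ℝ → ℝ} (hf : ∀ i, Measurable (f i)) :
    ∫ ω, ∏ i ∈ s, f i (X i ω) ∂P = ∏ i ∈ s, ∫ ω, f i (X i ω) ∂P := by
  have h := (hind.precomp (g := fun i : s => (i : α))
    Subtype.val_injective).integral_fun_prod_comp (f := fun i : s => f i) 
    (fun i => (hX i).aemeasurable) (fun i => (hf i).aestronglyMeasurable)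
  rw [← Finset.prod_coe_sort s (fun i => ∫ ω, f i (X i ω) ∂P), ← h]
  congr 1 with ω
  exact (Finset.prod_coe_sort s (fun i => f i (X i ω))).symm

theorem integral_prod_pow_four (hX : ∀ i, Measurable (X i)) (hind : iIndepFun X P)
    (hβ : ∀ i, ∫ ω, X i ω ^ 4 ∂P = β) (J : Finset α) :
    ∫ ω, (∏ i ∈ J, X i ω) ^ 4 ∂P = β ^ J.card := by
  simp only [← Finset.prod_pow]
  rw [integral_finset_prod_comp hX hind J (f := fun _ x => x ^ 4)
    fun _ => measurable_id.pow_const 4]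
  simp [hβ]

variable [DecidableEq α]

/-- The number of the four sets which contain `i`. -/
def multiplicity₄ (J₁ J₂ J₃ J₄ : Finset α) (i : α) : ℕ :=
  (if i ∈ J₁ then 1 else 0) + (if i ∈ J₂ then 1 else 0) + (if i ∈ J₃ then 1 else 0) +
    (if i ∈ J₄ then 1 else 0)

theorem prod_four_eq (J₁ J₂ J₃ J₄ : Finset α) (x : α → ℝ) :
    (∏ i ∈ J₁, x i) * (∏ i ∈ J₂, x i) * (∏ i ∈ J₃, x i) * (∏ i ∈ J₄, x i) =
      ∏ i ∈ J₁ ∪ J₂ ∪ J₃ ∪ J₄, x i ^ multiplicity₄ J₁ J₂ J₃ J₄ i := by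
  have h : ∀ J ⊆ J₁ ∪ J₂ ∪ J₃ ∪ J₄, ∏ i ∈ J, x i =
      ∏ i ∈ J₁ ∪ J₂ ∪ J₃ ∪ J₄, x i ^ (if i ∈ J then 1 else 0) := fun J hJ => by
    have e : ∏ i ∈ J, x i = ∏ i ∈ J₁ ∪ J₂ ∪ J₃ ∪ J₄, if i ∈ J then x i else 1 := by
      rw [Finset.prod_ite_mem, Finset.inter_eq_right.2 hJ]
    rw [e]
    refine Finset.prod_congr rfl fun i _ => ?_
    split_ifs <;> simp
  rw [h J₁, h J₂, h J₃, h J₄]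
  · simp only [← Finset.prod_mul_distrib, multiplicity₄, pow_add]
  all_goals intro x hx; simp [hx]

theorem integrable_finset_prod [IsProbabilityMeasure P] {Z : α → Ω → ℝ}
    (hZ : ∀ i, Measurable (Z i)) (hind : iIndepFun Z P)
    (h_int : ∀ i, Integrable (Z i) P) (s : Finset α) :
    Integrable (fun ω => ∏ i ∈ s, Z i ω) P := by
  induction s using Finset.induction_on with
  | empty => simp
  | insert a s ha ih =>
    simp only [Finset.prod_insert ha]
    have h := hind.indepFun_finsetProd_of_notMem hZ ha
    have e : (∏ i ∈ s, Z i) = fun ω => ∏ i ∈ s, Z i ω := by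
      ext ω; rw [Finset.prod_apply]
    rw [e] at h
    exact h.symm.integrable_mul (h_int a) ih

theorem integrable_prod_pow_four [IsProbabilityMeasure P] (hX : ∀ i, Measurable (X i))
    (hind : iIndepFun X P)
    (h4 : ∀ i, Integrable (fun ω => X i ω ^ 4) P) (J : Finset α) :
    Integrable (fun ω => (∏ i ∈ J, X i ω) ^ 4) P := by
  have h := integrable_finset_prod (Z := fun i ω => X i ω ^ 4) (fun i => (hX i).pow_const 4)
    (hind.comp (fun _ x => x ^ 4) fun _ => measurable_id.pow_const 4) h4 J
  simpa only [Finset.prod_pow] using h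

theorem integral_prod_four (hX : ∀ i, Measurable (X i)) (hind : iIndepFun X P)
    (J₁ J₂ J₃ J₄ : Finset α) :
    ∫ ω, (∏ i ∈ J₁, X i ω) * (∏ i ∈ J₂, X i ω) * (∏ i ∈ J₃, X i ω) * (∏ i ∈ J₄, X i ω) ∂P =
      ∏ i ∈ J₁ ∪ J₂ ∪ J₃ ∪ J₄, ∫ ω, X i ω ^ multiplicity₄ J₁ J₂ J₃ J₄ i ∂P := by
  simp only [prod_four_eq]
  exact integral_finset_prod_comp hX hind _ (f := fun i x => x ^ multiplicity₄ J₁ J₂ J₃ J₄ i)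
    fun i => measurable_id.pow_const _

theorem integral_prod_four_eq_zero (hX : ∀ i, Measurable (X i)) (hind : iIndepFun X P)
    (h1 : ∀ i, ∫ ω, X i ω ∂P = 0) {J₁ J₂ J₃ J₄ : Finset α} (h : ¬ DoublyCovered J₁ J₂ J₃ J₄) :
    ∫ ω, (∏ i ∈ J₁, X i ω) * (∏ i ∈ J₂, X i ω) * (∏ i ∈ J₃, X i ω) * (∏ i ∈ J₄, X i ω) ∂P = 0 := by
  obtain ⟨i, hi, hm⟩ : ∃ i ∈ J₁ ∪ J₂ ∪ J₃ ∪ J₄, multiplicity₄ J₁ J₂ J₃ J₄ i = 1 := by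
    by_contra! hne
    have hne' : ∀ i, i ∈ J₁ ∨ i ∈ J₂ ∨ i ∈ J₃ ∨ i ∈ J₄ → multiplicity₄ J₁ J₂ J₃ J₄ i ≠ 1 :=
      fun i hi => hne i (by simp only [Finset.mem_union]; tauto)
    clear hne
    refine h ⟨?_, ?_, ?_, ?_⟩ <;>
    · intro i hi
      have := hne' i (by tauto)
      simp only [Finset.mem_union]
      by_contra hc
      push Not at hc
      simp [multiplicity₄, hi, hc] at this
  rw [integral_prod_four hX hind]
  exact Finset.prod_eq_zero hi (by simp [hm, h1])

theorem integral_prod_four_eq_one (hX : ∀ i, Measurable (X i)) (hind : iIndepFun X P)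
    (h2 : ∀ i, ∫ ω, X i ω ^ 2 ∂P = 1) {J L : Finset α} (h : Disjoint J L) :
    ∫ ω, (∏ i ∈ J, X i ω) * (∏ i ∈ J, X i ω) * (∏ i ∈ L, X i ω) * (∏ i ∈ L, X i ω) ∂P = 1 := by
  rw [integral_prod_four hX hind]
  refine Finset.prod_eq_one fun i hm => ?_
  have hd : i ∈ J → i ∉ L := fun hi => Finset.disjoint_left.1 h hi
  by_cases hi : i ∈ J
  · simp [multiplicity₄, hi, hd hi, h2]
  · have hi' : i ∈ L := by simpa [hi] using hm
    simp [multiplicity₄, hi, hi', h2]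

theorem integral_prod_mul_prod (hX : ∀ i, Measurable (X i)) (hind : iIndepFun X P)
    (h1 : ∀ i, ∫ ω, X i ω ∂P = 0) (h2 : ∀ i, ∫ ω, X i ω ^ 2 ∂P = 1) (J L : Finset α) :
    ∫ ω, (∏ i ∈ J, X i ω) * (∏ i ∈ L, X i ω) ∂P = if J = L then 1 else 0 := by
  have e : ∫ ω, (∏ i ∈ J, X i ω) * (∏ i ∈ L, X i ω) ∂P = ∫ ω, (∏ i ∈ J, X i ω) *
      (∏ i ∈ L, X i ω) * (∏ i ∈ ∅, X i ω) * (∏ i ∈ ∅, X i ω) ∂P := by simp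
  rw [e]
  split_ifs with h
  · subst h
    exact integral_prod_four_eq_one hX hind h2 (Finset.disjoint_empty_right _)
  · refine integral_prod_four_eq_zero hX hind h1 fun hc => h ?_
    obtain ⟨c₁, c₂, -⟩ := hc
    simp only [Finset.union_empty] at c₁ c₂
    exact c₁.antisymm c₂

theorem abs_mul_four_le (x y z w : ℝ) :
    |x * y * z * w| ≤ (x ^ 4 + y ^ 4 + z ^ 4 + w ^ 4) / 4 := by
  have h : ∀ a b : ℝ, |a * b| ≤ (a ^ 2 + b ^ 2) / 2 := fun a b =>
    abs_le.2 ⟨by nlinarith [sq_nonneg (a + b)], by nlinarith [sq_nonneg (a - b)]⟩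
  have e : x * y * z * w = (x * y) * (z * w) := by ring
  rw [e]
  refine (h _ _).trans ?_
  nlinarith [sq_nonneg (x ^ 2 - y ^ 2), sq_nonneg (z ^ 2 - w ^ 2)]

theorem integrable_mul_four {Y₁ Y₂ Y₃ Y₄ : Ω → ℝ} (m₁ : Measurable Y₁) (m₂ : Measurable Y₂)
    (m₃ : Measurable Y₃) (m₄ : Measurable Y₄) (h₁ : Integrable (fun ω => Y₁ ω ^ 4) P)
    (h₂ : Integrable (fun ω => Y₂ ω ^ 4) P) (h₃ : Integrable (fun ω => Y₃ ω ^ 4) P)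
    (h₄ : Integrable (fun ω => Y₄ ω ^ 4) P) :
    Integrable (fun ω => Y₁ ω * Y₂ ω * Y₃ ω * Y₄ ω) P := by
  refine ((((h₁.add h₂).add h₃).add h₄).div_const 4).mono'
    (((m₁.mul m₂).mul m₃).mul m₄).aestronglyMeasurable (Filter.Eventually.of_forall fun ω => ?_)
  exact abs_mul_four_le _ _ _ _

theorem integrable_prod_four [IsProbabilityMeasure P] (hX : ∀ i, Measurable (X i))
    (hind : iIndepFun X P)
    (h4 : ∀ i, Integrable (fun ω => X i ω ^ 4) P) (J₁ J₂ J₃ J₄ : Finset α) :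
    Integrable (fun ω => (∏ i ∈ J₁, X i ω) * (∏ i ∈ J₂, X i ω) * (∏ i ∈ J₃, X i ω) *
      (∏ i ∈ J₄, X i ω)) P :=
  integrable_mul_four (Finset.measurable_prod _ fun i _ => hX i)
    (Finset.measurable_prod _ fun i _ => hX i) (Finset.measurable_prod _ fun i _ => hX i)
    (Finset.measurable_prod _ fun i _ => hX i) (integrable_prod_pow_four hX hind h4 _)
    (integrable_prod_pow_four hX hind h4 _) (integrable_prod_pow_four hX hind h4 _)
    (integrable_prod_pow_four hX hind h4 _)

theorem integrable_prod_mul_prod [IsProbabilityMeasure P] (hX : ∀ i, Measurable (X i))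
    (hind : iIndepFun X P)
    (h4 : ∀ i, Integrable (fun ω => X i ω ^ 4) P) (J L : Finset α) :
    Integrable (fun ω => (∏ i ∈ J, X i ω) * (∏ i ∈ L, X i ω)) P := by
  simpa using integrable_prod_four hX hind h4 J L ∅ ∅

theorem abs_integral_prod_four_le [IsProbabilityMeasure P] {q : ℕ}
    (hX : ∀ i, Measurable (X i)) (hind : iIndepFun X P)
    (h4 : ∀ i, Integrable (fun ω => X i ω ^ 4) P) (hβ : ∀ i, ∫ ω, X i ω ^ 4 ∂P = β)
    {J₁ J₂ J₃ J₄ : Finset α} (c₁ : J₁.card = q) (c₂ : J₂.card = q) (c₃ : J₃.card = q)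
    (c₄ : J₄.card = q) :
    |∫ ω, (∏ i ∈ J₁, X i ω) * (∏ i ∈ J₂, X i ω) * (∏ i ∈ J₃, X i ω) * (∏ i ∈ J₄, X i ω) ∂P| ≤
      β ^ q := by
  have k := fun J => integrable_prod_pow_four hX hind h4 J
  have e : ∫ ω, ((∏ i ∈ J₁, X i ω) ^ 4 + (∏ i ∈ J₂, X i ω) ^ 4 + (∏ i ∈ J₃, X i ω) ^ 4 +
      (∏ i ∈ J₄, X i ω) ^ 4) / 4 ∂P = β ^ q := by
    rw [integral_div, integral_add, integral_add, integral_add]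
    · simp only [integral_prod_pow_four hX hind hβ, c₁, c₂, c₃, c₄]
      ring
    exacts [k _, k _, (k _).add (k _), k _, ((k _).add (k _)).add (k _), k _]
  rw [← e]
  exact abs_integral_le_integral_abs.trans (integral_mono
    (integrable_prod_four hX hind h4 J₁ J₂ J₃ J₄).abs
    (((((k J₁).add (k J₂)).add (k J₃)).add (k J₄)).div_const 4)
    fun ω => abs_mul_four_le _ _ _ _)

end Moments

section Chaos
variable {α Ω : Type*}

/-- The homogeneous sum with coefficients `u` indexed by the sets in `F`. -/
noncomputable def homogeneousSum (F : Finset (Finset α)) (u : Finset α → ℝ) (x : α → ℝ) : ℝ :=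
  ∑ J ∈ F, u J * ∏ i ∈ J, x i

theorem measurable_homogeneousSum [MeasurableSpace Ω] (F : Finset (Finset α)) (u : Finset α → ℝ)
    {X : α → Ω → ℝ} (hX : ∀ i, Measurable (X i)) :
    Measurable (fun ω => homogeneousSum F u (fun i => X i ω)) :=
  Finset.measurable_sum _ fun _ _ => (Finset.measurable_prod _ fun i _ => hX i).const_mul _

theorem homogeneousSum_mul (F : Finset (Finset α)) (u v : Finset α → ℝ) (x : α → ℝ) :
    homogeneousSum F u x * homogeneousSum F v x =
      ∑ J ∈ F, ∑ L ∈ F, u J * v L * ((∏ i ∈ J, x i) * ∏ i ∈ L, x i) := by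
  rw [homogeneousSum, homogeneousSum, Finset.sum_mul_sum]
  exact Finset.sum_congr rfl fun J _ => Finset.sum_congr rfl fun L _ => by ring

theorem homogeneousSum_pow_four (F : Finset (Finset α)) (u : Finset α → ℝ) (x : α → ℝ) :
    homogeneousSum F u x ^ 4 = ∑ J₁ ∈ F, ∑ J₂ ∈ F, ∑ J₃ ∈ F, ∑ J₄ ∈ F, u J₁ * u J₂ * u J₃ * u J₄ *
      ((∏ i ∈ J₁, x i) * (∏ i ∈ J₂, x i) * (∏ i ∈ J₃, x i) * ∏ i ∈ J₄, x i) := by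
  have e : homogeneousSum F u x ^ 4 =
      (homogeneousSum F u x * homogeneousSum F u x) *
        (homogeneousSum F u x * homogeneousSum F u x) := by ring
  rw [e, homogeneousSum_mul]
  simp only [Finset.sum_mul, Finset.mul_sum]
  exact Finset.sum_congr rfl fun _ _ => Finset.sum_congr rfl fun _ _ =>
    Finset.sum_congr rfl fun _ _ => Finset.sum_congr rfl fun _ _ => by ring

theorem sum_sq_sum_four (F : Finset (Finset α)) (c : Finset α → Finset α → ℝ) (x : α → ℝ) :
    (∑ J ∈ F, ∑ L ∈ F, c J L * ((∏ i ∈ J, x i) * ∏ i ∈ L, x i)) ^ 2 =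
      ∑ J₁ ∈ F, ∑ J₂ ∈ F, ∑ J₃ ∈ F, ∑ J₄ ∈ F, c J₁ J₂ * c J₃ J₄ *
        ((∏ i ∈ J₁, x i) * (∏ i ∈ J₂, x i) * (∏ i ∈ J₃, x i) * ∏ i ∈ J₄, x i) := by
  rw [pow_two]
  simp only [Finset.sum_mul, Finset.mul_sum]
  exact Finset.sum_congr rfl fun _ _ => Finset.sum_congr rfl fun _ _ =>
    Finset.sum_congr rfl fun _ _ => Finset.sum_congr rfl fun _ _ => by ring

theorem memLp_four_of_integrable [MeasurableSpace Ω] {P : Measure Ω} {Y : Ω → ℝ} (hY : Measurable Y)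
    (h : Integrable (fun ω => Y ω ^ 4) P) : MemLp Y 4 P := by
  have h' : Integrable (fun ω => ‖Y ω‖ ^ (4 : ENNReal).toReal) P := by
    refine h.congr (Filter.Eventually.of_forall fun ω => ?_)
    have : (4 : ENNReal).toReal = ((4 : ℕ) : ℝ) := by simp
    simp only [this, Real.rpow_natCast, Real.norm_eq_abs]
    exact (Even.pow_abs (by decide) _).symm
  exact (integrable_norm_rpow_iff hY.aestronglyMeasurable (by norm_num) (by norm_num)).1 h'

variable [DecidableEq α] [MeasurableSpace Ω] {P : Measure Ω} [IsProbabilityMeasure P]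
  {X : α → Ω → ℝ} {β : ℝ}

theorem integral_homogeneousSum_sq (hX : ∀ i, Measurable (X i)) (hind : iIndepFun X P)
    (h1 : ∀ i, ∫ ω, X i ω ∂P = 0) (h2 : ∀ i, ∫ ω, X i ω ^ 2 ∂P = 1)
    (h4 : ∀ i, Integrable (fun ω => X i ω ^ 4) P) (F : Finset (Finset α)) (u : Finset α → ℝ) :
    ∫ ω, homogeneousSum F u (fun i => X i ω) ^ 2 ∂P = ∑ J ∈ F, u J ^ 2 := by
  simp only [pow_two (homogeneousSum _ _ _), homogeneousSum_mul]
  have hi := fun J L => (integrable_prod_mul_prod hX hind h4 J L).const_mul (u J * u L)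
  rw [integral_finsetSum _ fun J _ => integrable_finsetSum _ fun L _ => hi J L]
  refine Finset.sum_congr rfl fun J hJ => ?_
  rw [integral_finsetSum _ fun L _ => hi J L]
  simp only [integral_const_mul, integral_prod_mul_prod hX hind h1 h2]
  simp [hJ, pow_two]

theorem integrable_sum_four (hX : ∀ i, Measurable (X i)) (hind : iIndepFun X P)
    (h4 : ∀ i, Integrable (fun ω => X i ω ^ 4) P) (F : Finset (Finset α))
    (c : Finset α → Finset α → Finset α → Finset α → ℝ) :
    Integrable (fun ω => ∑ J₁ ∈ F, ∑ J₂ ∈ F, ∑ J₃ ∈ F, ∑ J₄ ∈ F, c J₁ J₂ J₃ J₄ *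
      ((∏ i ∈ J₁, X i ω) * (∏ i ∈ J₂, X i ω) * (∏ i ∈ J₃, X i ω) * ∏ i ∈ J₄, X i ω)) P :=
  integrable_finsetSum _ fun _ _ => integrable_finsetSum _ fun _ _ =>
    integrable_finsetSum _ fun _ _ => integrable_finsetSum _ fun _ _ =>
      (integrable_prod_four hX hind h4 _ _ _ _).const_mul _

theorem integral_sum_four (hX : ∀ i, Measurable (X i)) (hind : iIndepFun X P)
    (h4 : ∀ i, Integrable (fun ω => X i ω ^ 4) P) (F : Finset (Finset α))
    (c : Finset α → Finset α → Finset α → Finset α → ℝ) :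
    ∫ ω, ∑ J₁ ∈ F, ∑ J₂ ∈ F, ∑ J₃ ∈ F, ∑ J₄ ∈ F, c J₁ J₂ J₃ J₄ *
      ((∏ i ∈ J₁, X i ω) * (∏ i ∈ J₂, X i ω) * (∏ i ∈ J₃, X i ω) * ∏ i ∈ J₄, X i ω) ∂P =
    ∑ J₁ ∈ F, ∑ J₂ ∈ F, ∑ J₃ ∈ F, ∑ J₄ ∈ F, c J₁ J₂ J₃ J₄ *
      ∫ ω, (∏ i ∈ J₁, X i ω) * (∏ i ∈ J₂, X i ω) * (∏ i ∈ J₃, X i ω) * ∏ i ∈ J₄, X i ω ∂P := by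
  have hi := fun J₁ J₂ J₃ J₄ =>
    (integrable_prod_four hX hind h4 J₁ J₂ J₃ J₄).const_mul (c J₁ J₂ J₃ J₄)
  rw [integral_finsetSum _ fun _ _ => integrable_finsetSum _ fun _ _ =>
    integrable_finsetSum _ fun _ _ => integrable_finsetSum _ fun _ _ => hi _ _ _ _]
  refine Finset.sum_congr rfl fun J₁ _ => ?_
  rw [integral_finsetSum _ fun _ _ => integrable_finsetSum _ fun _ _ =>
    integrable_finsetSum _ fun _ _ => hi _ _ _ _]
  refine Finset.sum_congr rfl fun J₂ _ => ?_
  rw [integral_finsetSum _ fun _ _ => integrable_finsetSum _ fun _ _ => hi _ _ _ _]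
  refine Finset.sum_congr rfl fun J₃ _ => ?_
  rw [integral_finsetSum _ fun _ _ => hi _ _ _ _]
  exact Finset.sum_congr rfl fun J₄ _ => integral_const_mul _ _

theorem integrable_homogeneousSum_pow_four (hX : ∀ i, Measurable (X i)) (hind : iIndepFun X P)
    (h4 : ∀ i, Integrable (fun ω => X i ω ^ 4) P) (F : Finset (Finset α)) (u : Finset α → ℝ) :
    Integrable (fun ω => homogeneousSum F u (fun i => X i ω) ^ 4) P := by
  simp only [homogeneousSum_pow_four]
  exact integrable_sum_four hX hind h4 F fun J₁ J₂ J₃ J₄ => u J₁ * u J₂ * u J₃ * u J₄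

theorem integral_homogeneousSum_pow_four_le {q : ℕ} {F : Finset (Finset α)}
    (hF : ∀ J ∈ F, J.card = q) (hX : ∀ i, Measurable (X i)) (hind : iIndepFun X P)
    (h1 : ∀ i, ∫ ω, X i ω ∂P = 0) (h4 : ∀ i, Integrable (fun ω => X i ω ^ 4) P)
    (hβ : ∀ i, ∫ ω, X i ω ^ 4 ∂P = β) (hβ0 : 0 ≤ β) (u : Finset α → ℝ) :
    ∫ ω, homogeneousSum F u (fun i => X i ω) ^ 4 ∂P ≤
      256 ^ q * β ^ q * (∑ J ∈ F, u J ^ 2) ^ 2 := by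
  simp only [homogeneousSum_pow_four]
  rw [integral_sum_four hX hind h4 F fun J₁ J₂ J₃ J₄ => u J₁ * u J₂ * u J₃ * u J₄]
  have hn : 0 ≤ ∑ J ∈ F, u J ^ 2 := Finset.sum_nonneg fun _ _ => sq_nonneg _
  have key := mul_le_mul_of_nonneg_left (sum_doublyCovered_le hF (g₁ := fun J => |u J|)
    (g₂ := fun J => |u J|) (g₃ := fun J => |u J|) (g₄ := fun J => |u J|)
    (fun _ => abs_nonneg _) (fun _ => abs_nonneg _) (fun _ => abs_nonneg _)
    (fun _ => abs_nonneg _)) (pow_nonneg hβ0 q)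
  simp only [sq_abs] at key
  have hk : (∑ J ∈ F, u J ^ 2) ^ 2 = √(∑ J ∈ F, u J ^ 2) * √(∑ J ∈ F, u J ^ 2) *
      √(∑ J ∈ F, u J ^ 2) * √(∑ J ∈ F, u J ^ 2) := by
    rw [mul_assoc, Real.mul_self_sqrt hn, pow_two]
  rw [hk, mul_comm (256 ^ q) (β ^ q), mul_assoc]
  refine le_trans ?_ key
  simp only [Finset.mul_sum]
  refine Finset.sum_le_sum fun J₁ hJ₁ => Finset.sum_le_sum fun J₂ hJ₂ =>
    Finset.sum_le_sum fun J₃ hJ₃ => Finset.sum_le_sum fun J₄ hJ₄ => ?_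
  split_ifs with hd
  · refine (le_abs_self _).trans ?_
    rw [abs_mul, abs_mul, abs_mul, abs_mul, mul_comm (β ^ q)]
    exact mul_le_mul_of_nonneg_left (abs_integral_prod_four_le hX hind h4 hβ (hF _ hJ₁)
      (hF _ hJ₂) (hF _ hJ₃) (hF _ hJ₄)) (by positivity)
  · rw [integral_prod_four_eq_zero hX hind h1 hd, mul_zero, mul_zero]

end Chaos

section Fluctuation
variable {α Ω : Type*} [DecidableEq α]

/-- The part of the coefficient function `a` carried by the sets containing `j`. -/
noncomputable def through (a : Finset α → ℝ) (j : α) (J : Finset α) : ℝ := if j ∈ J then a J else 0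

theorem sum_through_sq (F : Finset (Finset α)) (a : Finset α → ℝ) (j : α) :
    ∑ J ∈ F, through a j J ^ 2 = influence F a j :=
  Finset.sum_congr rfl fun J _ => by simp only [through]; split_ifs <;> simp

theorem homogeneousSum_eq_sum_through {q : ℕ} (hq : q ≠ 0) {F : Finset (Finset α)}
    (hF : ∀ J ∈ F, J.card = q) (a : Finset α → ℝ) (x : α → ℝ) :
    homogeneousSum F a x =
      (q : ℝ)⁻¹ * ∑ j ∈ F.biUnion id, homogeneousSum F (through a j) x := by
  have hq' : (q : ℝ) ≠ 0 := by exact_mod_cast hq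
  rw [eq_inv_mul_iff_mul_eq₀ hq']
  simp only [homogeneousSum]
  rw [Finset.sum_comm, Finset.mul_sum]
  refine Finset.sum_congr rfl fun J hJ => ?_
  have hs : J ⊆ F.biUnion id := Finset.subset_biUnion_of_mem id hJ
  simp only [through, ite_mul, zero_mul]
  rw [← Finset.sum_filter, Finset.filter_mem_eq_inter, Finset.inter_eq_right.2 hs,
    Finset.sum_const, hF J hJ, nsmul_eq_mul]

theorem sum_homogeneousSum_through_sq (F : Finset (Finset α)) (a : Finset α → ℝ) (x : α → ℝ) :
    ∑ j ∈ F.biUnion id, homogeneousSum F (through a j) x ^ 2 =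
      ∑ J ∈ F, ∑ L ∈ F, ((J ∩ L).card : ℝ) * (a J * a L) * ((∏ i ∈ J, x i) * ∏ i ∈ L, x i) := by
  simp only [pow_two, homogeneousSum_mul]
  rw [Finset.sum_comm]
  refine Finset.sum_congr rfl fun J hJ => ?_
  rw [Finset.sum_comm]
  refine Finset.sum_congr rfl fun L _ => ?_
  have hs : J ∩ L ⊆ F.biUnion id :=
    Finset.inter_subset_left.trans (Finset.subset_biUnion_of_mem id hJ)
  have h : ∀ j, through a j J * through a j L * ((∏ i ∈ J, x i) * ∏ i ∈ L, x i) =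
      if j ∈ J ∩ L then a J * a L * ((∏ i ∈ J, x i) * ∏ i ∈ L, x i) else 0 := by
    intro j
    simp only [through, Finset.mem_inter]
    by_cases h₁ : j ∈ J <;> by_cases h₂ : j ∈ L <;> simp [h₁, h₂]
  simp only [h]
  rw [← Finset.sum_filter, Finset.filter_mem_eq_inter, Finset.inter_eq_right.2 hs,
    Finset.sum_const, nsmul_eq_mul]
  ring

variable [MeasurableSpace Ω] {P : Measure Ω} [IsProbabilityMeasure P] {X : α → Ω → ℝ} {β : ℝ}

theorem integral_sum_through_sq {q : ℕ} (hX : ∀ i, Measurable (X i)) (hind : iIndepFun X P)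
    (h1 : ∀ i, ∫ ω, X i ω ∂P = 0) (h2 : ∀ i, ∫ ω, X i ω ^ 2 ∂P = 1)
    (h4 : ∀ i, Integrable (fun ω => X i ω ^ 4) P) {F : Finset (Finset α)}
    (hF : ∀ J ∈ F, J.card = q) {a : Finset α → ℝ} (hsum : ∑ J ∈ F, a J ^ 2 = 1) :
    ∫ ω, ∑ j ∈ F.biUnion id, homogeneousSum F (through a j) (fun i => X i ω) ^ 2 ∂P = q := by
  have hi : ∀ j, Integrable (fun ω => homogeneousSum F (through a j) (fun i => X i ω) ^ 2) P := by
    intro j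
    exact ((memLp_four_of_integrable (measurable_homogeneousSum F _ hX)
      (integrable_homogeneousSum_pow_four hX hind h4 F _)).mono_exponent
        (by norm_num : (2 : ENNReal) ≤ 4)).integrable_sq
  rw [integral_finsetSum _ fun j _ => hi j]
  simp only [integral_homogeneousSum_sq hX hind h1 h2 h4, sum_through_sq]
  rw [sum_influence hF, hsum, mul_one]

theorem integral_sum_through_sq_sq_le {q : ℕ} (hX : ∀ i, Measurable (X i)) (hind : iIndepFun X P)
    (h1 : ∀ i, ∫ ω, X i ω ∂P = 0) (h2 : ∀ i, ∫ ω, X i ω ^ 2 ∂P = 1)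
    (h4 : ∀ i, Integrable (fun ω => X i ω ^ 4) P) (hβ : ∀ i, ∫ ω, X i ω ^ 4 ∂P = β)
    {F : Finset (Finset α)}
    (hF : ∀ J ∈ F, J.card = q) {a : Finset α → ℝ} (hsum : ∑ J ∈ F, a J ^ 2 = 1) :
    ∫ ω, (∑ j ∈ F.biUnion id, homogeneousSum F (through a j) (fun i => X i ω) ^ 2) ^ 2 ∂P ≤
      q ^ 2 * (1 + β ^ q * ∑ J₁ ∈ F, ∑ J₂ ∈ F, ∑ J₃ ∈ F, ∑ J₄ ∈ F,
        if Fluctuating J₁ J₂ J₃ J₄ then |a J₁| * |a J₂| * |a J₃| * |a J₄| else 0) := by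
  simp only [sum_homogeneousSum_through_sq, sum_sq_sum_four F
    fun J L => ((J ∩ L).card : ℝ) * (a J * a L)]
  rw [integral_sum_four hX hind h4 F fun J₁ J₂ J₃ J₄ =>
    ((J₁ ∩ J₂).card : ℝ) * (a J₁ * a J₂) * (((J₃ ∩ J₄).card : ℝ) * (a J₃ * a J₄))]
  have e : (1 : ℝ) = ∑ J₁ ∈ F, ∑ J₂ ∈ F, ∑ J₃ ∈ F, ∑ J₄ ∈ F,
      if J₂ = J₁ then (if J₄ = J₃ then a J₁ ^ 2 * a J₃ ^ 2 else 0) else 0 := by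
    have : (1 : ℝ) = ∑ J₁ ∈ F, ∑ J₃ ∈ F, a J₁ ^ 2 * a J₃ ^ 2 := by
      rw [← Finset.sum_mul_sum, hsum, one_mul]
    rw [this]
    refine Finset.sum_congr rfl fun J₁ h₁ => ?_
    rw [Finset.sum_comm]
    refine Finset.sum_congr rfl fun J₃ h₃ => ?_
    rw [Finset.sum_comm]
    simp [h₁, h₃]
  rw [e, Finset.mul_sum]
  simp only [← Finset.sum_add_distrib, Finset.mul_sum]
  refine Finset.sum_le_sum fun J₁ hJ₁ => Finset.sum_le_sum fun J₂ hJ₂ =>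
    Finset.sum_le_sum fun J₃ hJ₃ => Finset.sum_le_sum fun J₄ hJ₄ => ?_
  have hn : ∀ {J L : Finset α}, J ∈ F → ((J ∩ L).card : ℝ) ≤ q := fun {J L} hJ => by
    exact_mod_cast (Finset.card_le_card Finset.inter_subset_left).trans (hF J hJ).le
  have hβ0 : 0 ≤ β ^ q := (abs_nonneg _).trans
    (abs_integral_prod_four_le hX hind h4 hβ (hF _ hJ₁) (hF _ hJ₁) (hF _ hJ₁) (hF _ hJ₁))
  have hprod : ((J₁ ∩ J₂).card : ℝ) * (J₃ ∩ J₄).card ≤ q ^ 2 := by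
    rw [pow_two]
    exact mul_le_mul (hn hJ₁) (hn hJ₃) (by positivity) (by positivity)
  have hrhs : 0 ≤ (q : ℝ) ^ 2 * ((if J₂ = J₁ then (if J₄ = J₃ then a J₁ ^ 2 * a J₃ ^ 2 else 0)
      else 0) + β ^ q * if Fluctuating J₁ J₂ J₃ J₄ then |a J₁| * |a J₂| * |a J₃| * |a J₄|
      else 0) := by
    have : 0 ≤ if J₂ = J₁ then (if J₄ = J₃ then a J₁ ^ 2 * a J₃ ^ 2 else 0) else 0 := by
      split_ifs <;> positivity
    have : 0 ≤ if Fluctuating J₁ J₂ J₃ J₄ then |a J₁| * |a J₂| * |a J₃| * |a J₄| else 0 := by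
      split_ifs <;> positivity
    positivity
  by_cases hd : DoublyCovered J₁ J₂ J₃ J₄
  swap
  · rwa [integral_prod_four_eq_zero hX hind h1 hd, mul_zero]
  by_cases hl : Fluctuating J₁ J₂ J₃ J₄
  · rw [if_pos hl]
    refine (le_abs_self _).trans ?_
    simp only [abs_mul, Nat.abs_cast]
    calc _ = ((J₁ ∩ J₂).card : ℝ) * (J₃ ∩ J₄).card * ((|a J₁| * |a J₂| * |a J₃| * |a J₄|) *
          |∫ ω, (∏ i ∈ J₁, X i ω) * (∏ i ∈ J₂, X i ω) * (∏ i ∈ J₃, X i ω) *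
            (∏ i ∈ J₄, X i ω) ∂P|) := by ring
      _ ≤ q ^ 2 * ((|a J₁| * |a J₂| * |a J₃| * |a J₄|) * β ^ q) := by
        refine mul_le_mul hprod (mul_le_mul_of_nonneg_left (abs_integral_prod_four_le hX hind h4 hβ
          (hF _ hJ₁) (hF _ hJ₂) (hF _ hJ₃) (hF _ hJ₄)) (by positivity)) (by positivity)
          (by positivity)
      _ ≤ _ := by
        rw [mul_comm _ (β ^ q)]
        refine mul_le_mul_of_nonneg_left (le_add_of_nonneg_left ?_) (by positivity)
        split_ifs <;> positivity
  · rcases Finset.eq_empty_or_nonempty (J₁ ∩ J₂) with h12 | h12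
    · simpa [h12] using hrhs
    rcases Finset.eq_empty_or_nonempty (J₃ ∩ J₄) with h34 | h34
    · simpa [h34] using hrhs
    obtain ⟨rfl, rfl, hdis⟩ : J₁ = J₂ ∧ J₃ = J₄ ∧ Disjoint J₁ J₃ := by
      by_contra hcon
      exact hl ⟨hd, h12, h34, hcon⟩
    rw [integral_prod_four_eq_one hX hind h2 hdis, if_neg hl]
    simp only [if_true, mul_zero, add_zero, mul_one]
    calc _ = ((J₁ ∩ J₁).card : ℝ) * (J₃ ∩ J₃).card * (a J₁ ^ 2 * a J₃ ^ 2) := by ring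
      _ ≤ _ := mul_le_mul_of_nonneg_right hprod (by positivity)

end Fluctuation

section Bounds
variable {α Ω : Type*} [DecidableEq α] [MeasurableSpace Ω] {P : Measure Ω} [IsProbabilityMeasure P]
  {X : α → Ω → ℝ} {β : ℝ}

theorem integrable_homogeneousSum_sq (hX : ∀ i, Measurable (X i)) (hind : iIndepFun X P)
    (h4 : ∀ i, Integrable (fun ω => X i ω ^ 4) P) (F : Finset (Finset α)) (u : Finset α → ℝ) :
    Integrable (fun ω => homogeneousSum F u (fun i => X i ω) ^ 2) P :=
  ((memLp_four_of_integrable (measurable_homogeneousSum F _ hX)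
    (integrable_homogeneousSum_pow_four hX hind h4 F _)).mono_exponent
      (by norm_num : (2 : ENNReal) ≤ 4)).integrable_sq

theorem integral_abs_one_sub_sum_through_sq_le {q : ℕ} (hq : 1 ≤ q) (hX : ∀ i, Measurable (X i))
    (hind : iIndepFun X P) (h1 : ∀ i, ∫ ω, X i ω ∂P = 0) (h2 : ∀ i, ∫ ω, X i ω ^ 2 ∂P = 1)
    (h4 : ∀ i, Integrable (fun ω => X i ω ^ 4) P) (hβ : ∀ i, ∫ ω, X i ω ^ 4 ∂P = β)
    (hβ1 : 1 ≤ β) {F : Finset (Finset α)} (hF : ∀ J ∈ F, J.card = q) {a : Finset α → ℝ}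
    (hsum : ∑ J ∈ F, a J ^ 2 = 1)
    (hmul : ∀ J₁ J₂ J₃ J₄, J₁ \ J₂ = J₃ \ J₄ → J₂ \ J₁ = J₄ \ J₃ → a J₁ * a J₄ = a J₂ * a J₃)
    {τ B : ℝ} (hτ : ∀ i, influence F a i ≤ τ) (hτ0 : 0 ≤ τ) (hτ1 : τ ≤ 1) (hB : 0 < B)
    (hB2 : √τ + (∑ J ∈ F, ∑ L ∈ F, (if Recombinable F J L then a J ^ 2 * a L ^ 2 else 0)) ≤
      B ^ 2) :
    ∫ ω, |1 - (q : ℝ)⁻¹ *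
      ∑ j ∈ F.biUnion id, homogeneousSum F (through a j) (fun i => X i ω) ^ 2| ∂P ≤
      5 * q * 256 ^ q * β ^ q * B := by
  have hq1 : (1 : ℝ) ≤ q := by exact_mod_cast hq
  have hq0 : (0 : ℝ) < q := by linarith
  set T : Ω → ℝ := fun ω =>
    ∑ j ∈ F.biUnion id, homogeneousSum F (through a j) (fun i => X i ω) ^ 2 with hT
  have iT : Integrable T P :=
    integrable_finsetSum _ fun j _ => integrable_homogeneousSum_sq hX hind h4 F _
  have iT2 : Integrable (fun ω => T ω ^ 2) P := by
    simp only [hT, sum_homogeneousSum_through_sq, sum_sq_sum_four F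
      fun J L => ((J ∩ L).card : ℝ) * (a J * a L)]
    exact integrable_sum_four hX hind h4 F fun J₁ J₂ J₃ J₄ =>
      ((J₁ ∩ J₂).card : ℝ) * (a J₁ * a J₂) * (((J₃ ∩ J₄).card : ℝ) * (a J₃ * a J₄))
  have eT : ∫ ω, T ω ∂P = q := integral_sum_through_sq hX hind h1 h2 h4 hF hsum
  have eT2 := integral_sum_through_sq_sq_le hX hind h1 h2 h4 hβ hF hsum
  have hΦ := sum_fluctuating_le hF hsum hmul hτ
  set Φ := ∑ J₁ ∈ F, ∑ J₂ ∈ F, ∑ J₃ ∈ F, ∑ J₄ ∈ F,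
    if Fluctuating J₁ J₂ J₃ J₄ then |a J₁| * |a J₂| * |a J₃| * |a J₄| else 0
  set κ := ∑ J ∈ F, ∑ L ∈ F, (if Recombinable F J L then a J ^ 2 * a L ^ 2 else 0)
  have hκ : 0 ≤ κ := Finset.sum_nonneg fun J _ => Finset.sum_nonneg fun L _ => by
    split_ifs <;> positivity
  have hττ : τ ≤ √τ := Real.le_sqrt_of_sq_le (by nlinarith)
  have hΦ' : Φ ≤ 256 ^ q * (5 * q * B ^ 2) := by
    refine hΦ.trans (mul_le_mul_of_nonneg_left ?_ (by positivity))
    nlinarith [mul_le_mul_of_nonneg_left hττ hq0.le, mul_le_mul_of_nonneg_left hB2 hq0.le,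
      mul_le_mul_of_nonneg_right hq1 hκ]
  have pt : ∀ ω, |1 - (q : ℝ)⁻¹ * T ω| ≤ (B + (1 - 2 * (q : ℝ)⁻¹ * T ω +
      ((q : ℝ)⁻¹) ^ 2 * T ω ^ 2) / B) / 2 := by
    intro ω
    set t := 1 - (q : ℝ)⁻¹ * T ω with ht
    have : 1 - 2 * (q : ℝ)⁻¹ * T ω + ((q : ℝ)⁻¹) ^ 2 * T ω ^ 2 = |t| ^ 2 := by
      rw [sq_abs, ht]; ring
    rw [this, le_div_iff₀ two_pos, ← sub_nonneg]
    have : B + |t| ^ 2 / B - |t| * 2 = (B - |t|) ^ 2 / B := by field_simp; ring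
    rw [this]
    positivity
  have iR : Integrable (fun ω => 1 - 2 * (q : ℝ)⁻¹ * T ω + ((q : ℝ)⁻¹) ^ 2 * T ω ^ 2) P :=
    ((integrable_const 1).sub (iT.const_mul _)).add (iT2.const_mul _)
  have eR : ∫ ω, (1 - 2 * (q : ℝ)⁻¹ * T ω + ((q : ℝ)⁻¹) ^ 2 * T ω ^ 2) ∂P ≤ β ^ q * Φ := by
    have i₁ : Integrable (fun ω => 1 - 2 * (q : ℝ)⁻¹ * T ω) P :=
      (integrable_const 1).sub (iT.const_mul _)
    rw [integral_add i₁ (iT2.const_mul _), integral_sub (integrable_const 1) (iT.const_mul _),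
      integral_const_mul, integral_const_mul,
      eT]
    have := mul_le_mul_of_nonneg_left eT2 (sq_nonneg (q : ℝ)⁻¹)
    have e : ((q : ℝ)⁻¹) ^ 2 * (q ^ 2 * (1 + β ^ q * Φ)) = 1 + β ^ q * Φ := by field_simp
    rw [e] at this
    have e2 : 2 * (q : ℝ)⁻¹ * q = 2 := by field_simp
    rw [e2]
    simp only [integral_const, probReal_univ, smul_eq_mul, mul_one]
    simp only [hT] at this ⊢
    linarith
  have hM : (1 : ℝ) ≤ 5 * q * 256 ^ q * β ^ q := by
    have h₁ : (1 : ℝ) ≤ 256 ^ q := one_le_pow₀ (by norm_num)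
    have h₂ : (1 : ℝ) ≤ β ^ q := one_le_pow₀ hβ1
    have h₃ : (1 : ℝ) ≤ 5 * q := by linarith
    exact one_le_mul_of_one_le_of_one_le (one_le_mul_of_one_le_of_one_le h₃ h₁) h₂
  have iA : Integrable (fun ω => |1 - (q : ℝ)⁻¹ * T ω|) P :=
    ((integrable_const 1).sub (iT.const_mul _)).abs
  calc ∫ ω, |1 - (q : ℝ)⁻¹ * T ω| ∂P
      ≤ ∫ ω, (B + (1 - 2 * (q : ℝ)⁻¹ * T ω + ((q : ℝ)⁻¹) ^ 2 * T ω ^ 2) / B) / 2 ∂P :=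
        integral_mono iA (((integrable_const B).add (iR.div_const B)).div_const 2) pt
    _ = (B + (∫ ω, (1 - 2 * (q : ℝ)⁻¹ * T ω + ((q : ℝ)⁻¹) ^ 2 * T ω ^ 2) ∂P) / B) / 2 := by
        rw [integral_div, integral_add (integrable_const B) (iR.div_const B), integral_div]
        simp
    _ ≤ (B + (β ^ q * (256 ^ q * (5 * q * B ^ 2))) / B) / 2 := by
        have : β ^ q * Φ ≤ β ^ q * (256 ^ q * (5 * q * B ^ 2)) :=
          mul_le_mul_of_nonneg_left hΦ' (by positivity)
        gcongr
        exact eR.trans this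
    _ = (B + 5 * q * 256 ^ q * β ^ q * B) / 2 := by field_simp
    _ ≤ _ := by nlinarith

theorem sum_integral_abs_pow_three_le {q : ℕ} (hX : ∀ i, Measurable (X i))
    (hind : iIndepFun X P) (h1 : ∀ i, ∫ ω, X i ω ∂P = 0) (h2 : ∀ i, ∫ ω, X i ω ^ 2 ∂P = 1)
    (h4 : ∀ i, Integrable (fun ω => X i ω ^ 4) P) (hβ : ∀ i, ∫ ω, X i ω ^ 4 ∂P = β)
    (hβ1 : 1 ≤ β) {F : Finset (Finset α)} (hF : ∀ J ∈ F, J.card = q) {a : Finset α → ℝ}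
    (hsum : ∑ J ∈ F, a J ^ 2 = 1) {τ : ℝ} (hτ : ∀ i, influence F a i ≤ τ) (hτ0 : 0 < τ) :
    ∑ j ∈ F.biUnion id, ∫ ω, |homogeneousSum F (through a j) (fun i => X i ω)| ^ 3 ∂P ≤
      q * (256 ^ q * β ^ q * √τ) := by
  have hM : (1 : ℝ) ≤ 256 ^ q * β ^ q := one_le_mul_of_one_le_of_one_le
    (one_le_pow₀ (by norm_num)) (one_le_pow₀ hβ1)
  have hs : 0 < √τ := Real.sqrt_pos.2 hτ0
  have hj : ∀ j, ∫ ω, |homogeneousSum F (through a j) (fun i => X i ω)| ^ 3 ∂P ≤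
      influence F a j * (256 ^ q * β ^ q * √τ) := by
    intro j
    set Y : Ω → ℝ := fun ω => homogeneousSum F (through a j) (fun i => X i ω) with hY
    have i2 : Integrable (fun ω => Y ω ^ 2) P := integrable_homogeneousSum_sq hX hind h4 F _
    have i4 : Integrable (fun ω => Y ω ^ 4) P := integrable_homogeneousSum_pow_four hX hind h4 F _
    have e2 : ∫ ω, Y ω ^ 2 ∂P = influence F a j := by
      rw [← sum_through_sq]; exact integral_homogeneousSum_sq hX hind h1 h2 h4 F _
    have e4 : ∫ ω, Y ω ^ 4 ∂P ≤ 256 ^ q * β ^ q * influence F a j ^ 2 := by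
      rw [← sum_through_sq]
      exact integral_homogeneousSum_pow_four_le hF hX hind h1 h4 hβ (by linarith) _
    have hI := influence_nonneg F a j
    have pt : ∀ ω, |Y ω| ^ 3 ≤ (√τ * Y ω ^ 2 + Y ω ^ 4 / √τ) / 2 := by
      intro ω
      have e4 : Y ω ^ 4 = |Y ω| ^ 4 := (Even.pow_abs (by decide) _).symm
      rw [← sq_abs (Y ω), e4, le_div_iff₀ two_pos, ← sub_nonneg]
      have : √τ * |Y ω| ^ 2 + |Y ω| ^ 4 / √τ - |Y ω| ^ 3 * 2 =
          |Y ω| ^ 2 * (√τ - |Y ω|) ^ 2 / √τ := by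
        field_simp; ring
      rw [this]
      positivity
    calc ∫ ω, |Y ω| ^ 3 ∂P ≤ ∫ ω, (√τ * Y ω ^ 2 + Y ω ^ 4 / √τ) / 2 ∂P :=
          integral_mono_of_nonneg (Filter.Eventually.of_forall fun ω => by positivity)
            (((i2.const_mul _).add (i4.div_const _)).div_const 2) (Filter.Eventually.of_forall pt)
      _ = (√τ * influence F a j + (∫ ω, Y ω ^ 4 ∂P) / √τ) / 2 := by
          rw [integral_div, integral_add (i2.const_mul _) (i4.div_const _), integral_div,
            integral_const_mul, e2]
      _ ≤ (√τ * influence F a j + (256 ^ q * β ^ q * (influence F a j * √τ ^ 2)) / √τ) / 2 := by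
          have h : influence F a j ^ 2 ≤ influence F a j * √τ ^ 2 := by
            rw [Real.sq_sqrt hτ0.le, pow_two]
            exact mul_le_mul_of_nonneg_left (hτ j) hI
          gcongr
          exact e4.trans (mul_le_mul_of_nonneg_left h (by linarith))
      _ = (√τ * influence F a j + 256 ^ q * β ^ q * (√τ * influence F a j)) / 2 := by
          field_simp
      _ ≤ _ := by nlinarith [mul_nonneg hs.le hI]
  refine (Finset.sum_le_sum fun j _ => hj j).trans ?_
  rw [← Finset.sum_mul, sum_influence hF, hsum, mul_one]

end Bounds

section Decoupling
variable {α Ω : Type*} [DecidableEq α]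

theorem homogeneousSum_through (F : Finset (Finset α)) (a : Finset α → ℝ) (j : α) (x : α → ℝ) :
    homogeneousSum F (through a j) x =
      x j * ∑ J ∈ F, through a j J * ∏ i ∈ J.erase j, x i := by
  rw [homogeneousSum, Finset.mul_sum]
  refine Finset.sum_congr rfl fun J _ => ?_
  by_cases h : j ∈ J
  · rw [← Finset.mul_prod_erase J x h]; ring
  · simp [through, h]

variable [MeasurableSpace Ω] {P : Measure Ω} {X : α → Ω → ℝ}

/-- A function of all coordinates other than `j` is independent of `X j`. -/
theorem integral_mul_eq_zero_of_erase (hX : ∀ i, Measurable (X i)) (hind : iIndepFun X P)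
    (h1 : ∀ i, ∫ ω, X i ω ∂P = 0) (s : Finset α) (j : α) {G : (α → ℝ) → ℝ} (hG : Measurable G)
    (hGs : ∀ x y : α → ℝ, (∀ i ∈ s.erase j, x i = y i) → G x = G y) :
    ∫ ω, X j ω * G (fun i => X i ω) ∂P = 0 := by
  have h := hind.indepFun_finset {j} (s.erase j)
    (by simp) hX
  let ext : (↥(s.erase j) → ℝ) → α → ℝ := fun v i =>
    if h : i ∈ s.erase j then v ⟨i, h⟩ else 0
  have hext : Measurable ext := by
    refine measurable_pi_lambda _ fun i => ?_
    by_cases hi : i ∈ s.erase j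
    · simp only [ext, hi, dif_pos]; exact measurable_pi_apply _
    · simp only [ext, hi, dif_neg, not_false_eq_true]; exact measurable_const
  have hev : Measurable fun v : ↥({j} : Finset α) → ℝ => v ⟨j, by simp⟩ := measurable_pi_apply _
  have h' := h.comp (φ := fun v : ↥({j} : Finset α) → ℝ => v ⟨j, by simp⟩) (ψ := fun v => G (ext v))
    hev (hG.comp hext)
  have hGe : ∀ ω, G (ext fun i => X i ω) = G (fun i => X i ω) := fun ω =>
    hGs _ _ fun i hi => by simp only [ext, hi, dif_pos]
  have := h'.integral_fun_mul_eq_mul_integral (by fun_prop)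
    ((hG.comp hext).comp (measurable_pi_lambda _ fun i => hX i)).aestronglyMeasurable
  simp only [Function.comp_def] at this
  simp only [hGe, h1, zero_mul] at this
  exact this

theorem integral_through_mul_eq_zero (hX : ∀ i, Measurable (X i)) (hind : iIndepFun X P)
    (h1 : ∀ i, ∫ ω, X i ω ∂P = 0) (F : Finset (Finset α)) (a : Finset α → ℝ) (j : α)
    {f : ℝ → ℝ} (hf : Measurable f) :
    ∫ ω, homogeneousSum F (through a j) (fun i => X i ω) *
      f (homogeneousSum F a (fun i => X i ω) -
        homogeneousSum F (through a j) (fun i => X i ω)) ∂P = 0 := by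
  have e : ∀ x : α → ℝ, homogeneousSum F a x - homogeneousSum F (through a j) x =
      ∑ J ∈ F, (if j ∈ J then 0 else a J) * ∏ i ∈ J, x i := by
    intro x
    rw [homogeneousSum, homogeneousSum, ← Finset.sum_sub_distrib]
    refine Finset.sum_congr rfl fun J _ => ?_
    simp only [through]; split_ifs <;> ring
  simp only [e]
  simp only [homogeneousSum_through, mul_assoc]
  refine integral_mul_eq_zero_of_erase hX hind h1 (F.biUnion id) j (G := fun x =>
    (∑ J ∈ F, through a j J * ∏ i ∈ J.erase j, x i) *
      f (∑ J ∈ F, (if j ∈ J then 0 else a J) * ∏ i ∈ J, x i)) ?_ ?_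
  · refine Measurable.mul (by fun_prop) (hf.comp (by fun_prop))
  · intro x y hxy
    have hs : ∀ J ∈ F, ∀ i ∈ J, i ≠ j → x i = y i := fun J hJ i hi hij =>
      hxy i (Finset.mem_erase.2 ⟨hij, Finset.mem_biUnion.2 ⟨J, hJ, hi⟩⟩)
    have e₁ : ∑ J ∈ F, through a j J * ∏ i ∈ J.erase j, x i =
        ∑ J ∈ F, through a j J * ∏ i ∈ J.erase j, y i :=
      Finset.sum_congr rfl fun J hJ => by
        rw [Finset.prod_congr rfl fun i hi =>
          hs J hJ i (Finset.mem_of_mem_erase hi) (Finset.ne_of_mem_erase hi)]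
    have e₂ : ∑ J ∈ F, (if j ∈ J then 0 else a J) * ∏ i ∈ J, x i =
        ∑ J ∈ F, (if j ∈ J then 0 else a J) * ∏ i ∈ J, y i :=
      Finset.sum_congr rfl fun J hJ => by
        by_cases hj : j ∈ J
        · simp [hj]
        · rw [Finset.prod_congr rfl fun i hi =>
            hs J hJ i hi fun h => hj (h ▸ hi)]
    simp only [e₁, e₂]

theorem abs_integral_homogeneousSum_sub_gaussian_le [IsProbabilityMeasure P] {q : ℕ} {β : ℝ}
    (hq : 1 ≤ q) (hX : ∀ i, Measurable (X i))
    (hind : iIndepFun X P) (h1 : ∀ i, ∫ ω, X i ω ∂P = 0) (h2 : ∀ i, ∫ ω, X i ω ^ 2 ∂P = 1)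
    (h4 : ∀ i, Integrable (fun ω => X i ω ^ 4) P) (hβ : ∀ i, ∫ ω, X i ω ^ 4 ∂P = β)
    (hβ1 : 1 ≤ β) {F : Finset (Finset α)} (hF : ∀ J ∈ F, J.card = q) {a : Finset α → ℝ}
    (hsum : ∑ J ∈ F, a J ^ 2 = 1)
    (hmul : ∀ J₁ J₂ J₃ J₄, J₁ \ J₂ = J₃ \ J₄ → J₂ \ J₁ = J₄ \ J₃ → a J₁ * a J₄ = a J₂ * a J₃)
    {τ : ℝ} (hτ : ∀ i, influence F a i ≤ τ) (hτ0 : 0 < τ) (hτ1 : τ ≤ 1)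
    {h : ℝ → ℝ} (hh : LipschitzWith 1 h) :
    |(∫ ω, h (homogeneousSum F a fun i => X i ω) ∂P) - ∫ y, h y ∂gaussianReal 0 1| ≤
      52 * q * 256 ^ q * β ^ q *
        (√(∑ J ∈ F, ∑ L ∈ F, (if Recombinable F J L then a J ^ 2 * a L ^ 2 else 0)) + √√τ) := by
  have hq0 : (0 : ℝ) < q := by exact_mod_cast hq
  set κ := ∑ J ∈ F, ∑ L ∈ F, (if Recombinable F J L then a J ^ 2 * a L ^ 2 else 0)
  have hκ : 0 ≤ κ := Finset.sum_nonneg fun J _ => Finset.sum_nonneg fun L _ => by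
    split_ifs <;> positivity
  have hs : 0 < √τ := Real.sqrt_pos.2 hτ0
  have hss : 0 < √√τ := Real.sqrt_pos.2 hs
  have hs1 : √τ ≤ 1 := Real.sqrt_le_one.2 hτ1
  have hs' : √τ ≤ √√τ := Real.le_sqrt_of_sq_le (by nlinarith)
  have hB : 0 < √κ + √√τ := by positivity
  have hB2 : √τ + κ ≤ (√κ + √√τ) ^ 2 := by
    nlinarith [Real.sq_sqrt hκ, Real.sq_sqrt hs.le, Real.sqrt_nonneg κ,
      mul_nonneg (Real.sqrt_nonneg κ) hss.le]
  have hβ0 : 0 ≤ β ^ q := by positivity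
  refine (abs_integral_sub_gaussian_le hq0
    (Y := fun j ω => homogeneousSum F (through a j) fun i => X i ω) (s := F.biUnion id)
    (fun j _ => measurable_homogeneousSum F _ hX)
    (fun j _ => memLp_four_of_integrable (measurable_homogeneousSum F _ hX)
      (integrable_homogeneousSum_pow_four hX hind h4 F _))
    (fun ω => homogeneousSum_eq_sum_through (by omega) hF a _)
    (fun j _ f hf _ => integral_through_mul_eq_zero hX hind h1 F a j hf.measurable) hh).trans ?_
  have b₁ := integral_abs_one_sub_sum_through_sq_le hq hX hind h1 h2 h4 hβ hβ1 hF hsum hmul hτ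
    hτ0.le hτ1 hB hB2
  have b₂ := sum_integral_abs_pow_three_le hX hind h1 h2 h4 hβ hβ1 hF hsum hτ hτ0
  have b₃ : 12 * (q : ℝ)⁻¹ * ∑ j ∈ F.biUnion id,
      ∫ ω, |homogeneousSum F (through a j) (fun i => X i ω)| ^ 3 ∂P ≤
      12 * (q * (256 ^ q * β ^ q * (√κ + √√τ))) := by
    calc _ ≤ 12 * (q : ℝ)⁻¹ * (q * (256 ^ q * β ^ q * √τ)) := by gcongr
      _ = 12 * (1 * (256 ^ q * β ^ q * √τ)) := by field_simp
      _ ≤ _ := by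
        have : √τ ≤ √κ + √√τ := by linarith [Real.sqrt_nonneg κ]
        have : (1 : ℝ) ≤ q := by exact_mod_cast hq
        gcongr
  calc _ ≤ 8 * (5 * q * 256 ^ q * β ^ q * (√κ + √√τ)) +
        12 * (q * (256 ^ q * β ^ q * (√κ + √√τ))) :=
        add_le_add (mul_le_mul_of_nonneg_left b₁ (by norm_num)) b₃
    _ = _ := by ring

end Decoupling

section Tuples
variable {α : Type*} [DecidableEq α] {q : ℕ}

/-- The set of coordinates of a tuple. -/
def coords (v : Fin q → α) : Finset α := Finset.univ.image v

theorem mem_coords {v : Fin q → α} {j : α} : j ∈ coords v ↔ ∃ k, v k = j := by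
  simp [coords]

theorem coe_coords (v : Fin q → α) : (coords v : Set α) = Set.range v := by
  simp [coords]

theorem card_coords {v : Fin q → α} (h : Function.Injective v) : (coords v).card = q := by
  simp [coords, Finset.card_image_of_injective _ h]

theorem prod_coords {v : Fin q → α} (h : Function.Injective v) (f : α → ℝ) :
    ∏ i ∈ coords v, f i = ∏ k, f (v k) :=
  Finset.prod_image fun _ _ _ _ e => h e

theorem card_filter_coords_eq {K : Finset (Fin q → α)} (hinj : ∀ v ∈ K, Function.Injective v)
    (hperm : ∀ v ∈ K, ∀ σ : Equiv.Perm (Fin q), v ∘ σ ∈ K) {w : Fin q → α} (hw : w ∈ K) :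
    (K.filter fun v => coords v = coords w).card = q.factorial := by
  have hwi := hinj w hw
  have e : (K.filter fun v => coords v = coords w) =
      (Finset.univ : Finset (Equiv.Perm (Fin q))).image
        fun σ : Equiv.Perm (Fin q) => w ∘ σ := by
    ext v
    simp only [Finset.mem_filter, Finset.mem_image, Finset.mem_univ, true_and]
    constructor
    · rintro ⟨hv, he⟩
      have hmem : ∀ k, ∃ l, w l = v k := fun k => mem_coords.1 (he ▸ mem_coords.2 ⟨k, rfl⟩)
      choose σ hσ using hmem
      have hσi : Function.Injective σ := fun k l h => hinj v hv (by rw [← hσ, ← hσ, h])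
      exact ⟨Equiv.ofBijective σ (Finite.injective_iff_bijective.1 hσi), funext hσ⟩
    · rintro ⟨σ, rfl⟩
      refine ⟨hperm w hw σ, ?_⟩
      ext j
      simp only [mem_coords, Function.comp_apply]
      exact ⟨fun ⟨k, hk⟩ => ⟨σ k, hk⟩, fun ⟨k, hk⟩ => ⟨σ.symm k, by simpa using hk⟩⟩
  rw [e, Finset.card_image_of_injective, Finset.card_univ, Fintype.card_perm, Fintype.card_fin]
  intro σ τ h
  exact Equiv.ext fun k => hwi (congrFun h k)

theorem sum_comp_coords {K : Finset (Fin q → α)} (hinj : ∀ v ∈ K, Function.Injective v)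
    (hperm : ∀ v ∈ K, ∀ σ : Equiv.Perm (Fin q), v ∘ σ ∈ K) (g : Finset α → ℝ) :
    ∑ v ∈ K, g (coords v) = q.factorial * ∑ J ∈ K.image coords, g J := by
  rw [← Finset.sum_fiberwise_of_maps_to (t := K.image coords) (g := coords)
    (fun v hv => Finset.mem_image_of_mem _ hv), Finset.mul_sum]
  refine Finset.sum_congr rfl fun J hJ => ?_
  obtain ⟨w, hw, rfl⟩ := Finset.mem_image.1 hJ
  rw [Finset.sum_congr rfl fun v hv => congrArg g (Finset.mem_filter.1 hv).2, Finset.sum_const,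
    card_filter_coords_eq hinj hperm hw, nsmul_eq_mul]

end Tuples

section Transfer
variable {q : ℕ} {K : Finset (Fin q → ℕ)}

theorem muB_eq (hinj : ∀ v ∈ K, Function.Injective v)
    (hperm : ∀ v ∈ K, ∀ σ : Equiv.Perm (Fin q), v ∘ σ ∈ K) (b : ℕ → ℝ) :
    muB b K = q.factorial * ∑ J ∈ K.image coords, (∏ i ∈ J, b i) ^ 2 := by
  rw [← sum_comp_coords hinj hperm, muB]
  refine Finset.sum_congr rfl fun v hv => ?_
  rw [prod_coords (hinj v hv), Finset.prod_pow]

theorem muB_Kstar_eq (hinj : ∀ v ∈ K, Function.Injective v)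
    (hperm : ∀ v ∈ K, ∀ σ : Equiv.Perm (Fin q), v ∘ σ ∈ K) (b : ℕ → ℝ) (j : ℕ) :
    muB b (Kstar K j) =
      q.factorial * influence (K.image coords) (fun J => ∏ i ∈ J, b i) j := by
  rw [influence, ← sum_comp_coords hinj hperm, muB, Kstar, Finset.sum_filter]
  refine Finset.sum_congr rfl fun v hv => ?_
  simp only [mem_coords, prod_coords (hinj v hv), Finset.prod_pow]

theorem muBsharp_eq (hinj : ∀ v ∈ K, Function.Injective v)
    (hperm : ∀ v ∈ K, ∀ σ : Equiv.Perm (Fin q), v ∘ σ ∈ K) (b : ℕ → ℝ) :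
    muBsharp b K = (q.factorial : ℝ) ^ 2 * ∑ J ∈ K.image coords, ∑ L ∈ K.image coords,
      if Recombinable (K.image coords) J L then (∏ i ∈ J, b i) ^ 2 * (∏ i ∈ L, b i) ^ 2 else 0 := by
  rw [pow_two, mul_assoc, Finset.mul_sum]
  simp only [← sum_comp_coords hinj hperm]
  rw [muBsharp, Ksharp, Finset.sum_filter, Finset.sum_product]
  refine Finset.sum_congr rfl fun v hv => Finset.sum_congr rfl fun w hw => ?_
  have hiff : (Set.range v ∩ Set.range w = ∅ ∧ ∃ k ∈ K, ∃ l ∈ K,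
      Set.range k ∪ Set.range l = Set.range v ∪ Set.range w ∧
      Set.range k ≠ Set.range v ∧ Set.range k ≠ Set.range w) ↔
      Recombinable (K.image coords) (coords v) (coords w) := by
    simp only [Recombinable, Finset.exists_mem_image, ← coe_coords, ← Finset.coe_inter,
      ← Finset.coe_union, Finset.coe_inj, Finset.coe_eq_empty, ne_eq]
  simp only [hiff, prod_coords (hinj v hv), prod_coords (hinj w hw), Finset.prod_pow]

theorem prod_mul_prod_eq_of_sdiff_eq {α : Type*} [DecidableEq α] (b : α → ℝ)
    {J₁ J₂ J₃ J₄ : Finset α} (h : J₁ \ J₂ = J₃ \ J₄) (h' : J₂ \ J₁ = J₄ \ J₃) :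
    (∏ i ∈ J₁, b i) * ∏ i ∈ J₄, b i = (∏ i ∈ J₂, b i) * ∏ i ∈ J₃, b i := by
  rw [← Finset.prod_inter_mul_prod_sdiff J₁ J₂ b, ← Finset.prod_inter_mul_prod_sdiff J₄ J₃ b,
    ← Finset.prod_inter_mul_prod_sdiff J₂ J₁ b, ← Finset.prod_inter_mul_prod_sdiff J₃ J₄ b, h, h',
    Finset.inter_comm J₂ J₁, Finset.inter_comm J₄ J₃]
  ring

theorem normalized_sum_eq_homogeneousSum (hinj : ∀ v ∈ K, Function.Injective v)
    (hperm : ∀ v ∈ K, ∀ σ : Equiv.Perm (Fin q), v ∘ σ ∈ K) (b x : ℕ → ℝ) :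
    (Real.sqrt (q.factorial * muB b K))⁻¹ * ∑ v ∈ K, (∏ i, b (v i)) * ∏ i, x (v i) =
      homogeneousSum (K.image coords)
        (fun J => (√(∑ L ∈ K.image coords, (∏ i ∈ L, b i) ^ 2))⁻¹ * ∏ i ∈ J, b i) x := by
  have hf : (0 : ℝ) < q.factorial := by exact_mod_cast q.factorial_pos
  have e : ∑ v ∈ K, (∏ i, b (v i)) * ∏ i, x (v i) =
      q.factorial * ∑ J ∈ K.image coords, (∏ i ∈ J, b i) * ∏ i ∈ J, x i := by
    rw [← sum_comp_coords hinj hperm]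
    refine Finset.sum_congr rfl fun v hv => ?_
    simp only [prod_coords (hinj v hv)]
  rw [e, muB_eq hinj hperm, ← mul_assoc (q.factorial : ℝ), Real.sqrt_mul (mul_self_nonneg _),
    Real.sqrt_mul_self hf.le, homogeneousSum, mul_inv_rev, mul_assoc, inv_mul_cancel_left₀ hf.ne',
    Finset.mul_sum]
  simp only [mul_assoc]

end Transfer

theorem one_le_integral_pow_four {Ω : Type*} [MeasurableSpace Ω] {P : Measure Ω}
    [IsProbabilityMeasure P] {Y : Ω → ℝ} (hY : Measurable Y) (h2 : ∫ ω, Y ω ^ 2 ∂P = 1)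
    (h4 : Integrable (fun ω => Y ω ^ 4) P) : 1 ≤ ∫ ω, Y ω ^ 4 ∂P := by
  have i2 : Integrable (fun ω => Y ω ^ 2) P :=
    ((memLp_four_of_integrable hY h4).mono_exponent
      (by norm_num : (2 : ENNReal) ≤ 4)).integrable_sq
  have h : ∫ ω, (2 * Y ω ^ 2 - 1) ∂P ≤ ∫ ω, Y ω ^ 4 ∂P :=
    integral_mono ((i2.const_mul 2).sub (integrable_const 1)) h4
      fun ω => by nlinarith [sq_nonneg (Y ω ^ 2 - 1)]
  rw [integral_sub (i2.const_mul 2) (integrable_const 1), integral_const_mul, h2] at h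
  simp only [integral_const, probReal_univ, smul_eq_mul, mul_one] at h
  linarith

theorem combinatorial_clt (q : ℕ) (hq : 1 ≤ q) :
    ∃ C : ℝ, 0 < C ∧
      ∀ (Ω : Type) [MeasureSpace Ω], IsProbabilityMeasure (ℙ : Measure Ω) →
      ∀ (K : Finset (Fin q → ℕ)) (b : ℕ → ℝ) (X : ℕ → Ω → ℝ),
        K.Nonempty →
        (∀ v ∈ K, Function.Injective v) →
        (∀ v ∈ K, ∀ σ : Equiv.Perm (Fin q), v ∘ σ ∈ K) →
        0 < muB b K →
        (∀ k, Measurable (X k)) →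
        iIndepFun X ℙ →
        (∀ k l, IdentDistrib (X k) (X l) ℙ ℙ) →
        (∫ ω, X 1 ω) = 0 →
        (∫ ω, (X 1 ω) ^ 2) = 1 →
        Integrable (fun ω => (X 1 ω) ^ 4) →
        dW (Measure.map
            (fun ω => (Real.sqrt (q.factorial * muB b K))⁻¹ *
              ∑ v ∈ K, (∏ i, b (v i)) * ∏ i, X (v i) ω) ℙ)
          stdGaussian ≤
          C * (∫ ω, (X 1 ω) ^ 4) ^ q *
            (Real.sqrt (muBsharp b K) / muB b K +
              ((⨆ j : ℕ, muB b (Kstar K j)) / muB b K) ^ ((1 : ℝ) / 4)) := by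
  have hq0 : (0 : ℝ) < q := by exact_mod_cast hq
  refine ⟨52 * q * 256 ^ q, by positivity, ?_⟩
  intro Ω _ hP K b X _ hinj hperm hm hX hind hid h1 h2 h4
  have := hP
  have hf : (0 : ℝ) < q.factorial := by exact_mod_cast q.factorial_pos
  have h1' : ∀ i, ∫ ω, X i ω = 0 := fun i => (hid i 1).integral_eq.trans h1
  have h2' : ∀ i, ∫ ω, X i ω ^ 2 = 1 := fun i =>
    ((hid i 1).comp (u := fun x => x ^ 2) (by fun_prop)).integral_eq.trans h2
  have hid4 : ∀ i, IdentDistrib (fun ω => X i ω ^ 4) (fun ω => X 1 ω ^ 4) ℙ ℙ := fun i =>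
    (hid i 1).comp (u := fun x => x ^ 4) (by fun_prop)
  have h4' : ∀ i, Integrable (fun ω => X i ω ^ 4) := fun i => (hid4 i).integrable_iff.2 h4
  have hβ : ∀ i, ∫ ω, X i ω ^ 4 = ∫ ω, X 1 ω ^ 4 := fun i => (hid4 i).integral_eq
  have hβ1 := one_le_integral_pow_four (hX 1) h2 h4
  have hS := fun ω => normalized_sum_eq_homogeneousSum hinj hperm b fun i => X i ω
  simp only [hS]
  rw [muB_eq hinj hperm] at hm ⊢
  simp only [muB_Kstar_eq hinj hperm, muBsharp_eq hinj hperm]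
  have hF : ∀ J ∈ K.image coords, J.card = q := by
    intro J hJ
    obtain ⟨v, hv, rfl⟩ := Finset.mem_image.1 hJ
    exact card_coords (hinj v hv)
  set F := K.image coords
  set p : Finset ℕ → ℝ := fun J => ∏ i ∈ J, b i with hp
  set m := ∑ J ∈ F, p J ^ 2 with hm_def
  have hm0 : 0 < m := pos_of_mul_pos_right hm hf.le
  set a : Finset ℕ → ℝ := fun J => (√m)⁻¹ * p J with ha
  have ha2 : ∀ J, a J ^ 2 = m⁻¹ * p J ^ 2 := fun J => by
    rw [ha, mul_pow, inv_pow, Real.sq_sqrt hm0.le]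
  have hsum : ∑ J ∈ F, a J ^ 2 = 1 := by
    simp only [ha2]
    rw [← Finset.mul_sum, inv_mul_cancel₀ hm0.ne']
  have hmul : ∀ J₁ J₂ J₃ J₄, J₁ \ J₂ = J₃ \ J₄ → J₂ \ J₁ = J₄ \ J₃ →
      a J₁ * a J₄ = a J₂ * a J₃ := by
    intro J₁ J₂ J₃ J₄ h h'
    have := prod_mul_prod_eq_of_sdiff_eq b h h'
    simp only [ha, hp]
    linear_combination (√m)⁻¹ * (√m)⁻¹ * this
  have hinf : ∀ j, influence F a j = influence F p j / m := by
    intro j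
    simp only [influence, ha2, Finset.sum_div]
    refine Finset.sum_congr rfl fun J _ => ?_
    split_ifs
    · rw [div_eq_inv_mul]
    · simp
  have hle : ∀ j, influence F p j ≤ m := fun j =>
    Finset.sum_le_sum fun J _ => by
      split_ifs
      exacts [le_rfl, sq_nonneg _]
  have hbdd : BddAbove (Set.range fun j => q.factorial * influence F p j) :=
    ⟨q.factorial * m, by rintro _ ⟨j, rfl⟩; exact mul_le_mul_of_nonneg_left (hle j) hf.le⟩
  set τ := (⨆ j, q.factorial * influence F p j) / (q.factorial * m) with hτ_def
  have hτ : ∀ j, influence F a j ≤ τ := by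
    intro j
    rw [hinf, ← mul_div_mul_left _ _ hf.ne']
    exact div_le_div_of_nonneg_right (le_ciSup hbdd j) hm.le
  have hτ1 : τ ≤ 1 := (div_le_one hm).2 (ciSup_le fun j =>
    mul_le_mul_of_nonneg_left (hle j) hf.le)
  have hτ0 : 0 < τ := by
    by_contra hcon
    have h := sum_influence hF a
    rw [hsum, mul_one] at h
    have : ∑ i ∈ F.biUnion id, influence F a i ≤ 0 :=
      Finset.sum_nonpos fun i _ => (hτ i).trans (not_lt.1 hcon)
    linarith
  have eτ : τ ^ ((1 : ℝ) / 4) = √√τ := by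
    rw [Real.sqrt_eq_rpow, Real.sqrt_eq_rpow, ← Real.rpow_mul hτ0.le]
    norm_num
  have eκ : √((q.factorial : ℝ) ^ 2 * ∑ J ∈ F, ∑ L ∈ F,
        if Recombinable F J L then p J ^ 2 * p L ^ 2 else 0) / (q.factorial * m) =
      √(∑ J ∈ F, ∑ L ∈ F, if Recombinable F J L then a J ^ 2 * a L ^ 2 else 0) := by
    have e : (∑ J ∈ F, ∑ L ∈ F, if Recombinable F J L then p J ^ 2 * p L ^ 2 else 0) =
        m ^ 2 * ∑ J ∈ F, ∑ L ∈ F, if Recombinable F J L then a J ^ 2 * a L ^ 2 else 0 := by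
      simp only [Finset.mul_sum, ha2]
      refine Finset.sum_congr rfl fun J _ => Finset.sum_congr rfl fun L _ => ?_
      split_ifs
      · field_simp
      · simp
    rw [e, ← mul_assoc, ← mul_pow, Real.sqrt_mul (sq_nonneg _), Real.sqrt_sq hm.le,
      mul_div_cancel_left₀ _ hm.ne']
  rw [eτ, eκ, dW]
  have : Nonempty {f : ℝ → ℝ // LipschitzWith 1 f} := ⟨⟨id, LipschitzWith.id⟩⟩
  refine ciSup_le fun h => ?_
  rw [integral_map (measurable_homogeneousSum F a hX).aemeasurable
    h.2.continuous.aestronglyMeasurable, _root_.stdGaussian]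
  exact abs_integral_homogeneousSum_sub_gaussian_le hq hX hind h1' h2' h4' hβ hβ1 hF hsum hmul hτ
    hτ0 hτ1 h.2
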